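/- Assume the Trudinger–Moser property on (−1,1) holds with some constant ω ∈ (0,π] and that f satisfies hypotheses (H) (with λ₁ the Poincaré constant of X'). Then the problem (−Δ)^{1/2} u = f(u) in (−1,1), u = 0 in ℝ∖(−1,1) has a nontrivial weak solution u ∈ X' that is even (u(−x) = u(x) for a.e. x) and nonincreasing on [0,∞). -/

import Mathlib

open MeasureTheory Real Set Filter Topology

noncomputable section

/-- Integrand of the squared Gagliardo `H^{1/2}` seminorm on `ℝ`. -/
def gagKer (u : ℝ → ℝ) : ℝ × ℝ → ℝ :=
  fun p => (u p.1 - u p.2) ^ 2 / |p.1 - p.2| ^ 2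

/-- Integrand of the Gagliardo inner product. -/
def innerKer (u v : ℝ → ℝ) : ℝ × ℝ → ℝ :=
  fun p => (u p.1 - u p.2) * (v p.1 - v p.2) / |p.1 - p.2| ^ 2

/-- `u ∈ H^{1/2}(ℝ)`. -/
def memH (u : ℝ → ℝ) : Prop :=
  Measurable u ∧ Integrable (fun x => (u x) ^ 2) ∧ Integrable (gagKer u)

/-- Squared Gagliardo seminorm `[u]²`. -/
def gagSq (u : ℝ → ℝ) : ℝ := ∫ p : ℝ × ℝ, gagKer u p

/-- Gagliardo seminorm `[u]`, i.e. the norm `‖u‖_{X'}`. -/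
def gagNorm (u : ℝ → ℝ) : ℝ := Real.sqrt (gagSq u)

/-- Inner product `⟨u, v⟩_{X'}`. -/
def innerX (u v : ℝ → ℝ) : ℝ := ∫ p : ℝ × ℝ, innerKer u v p

/-- `u ∈ X'` : `u ∈ H^{1/2}(ℝ)` and `u = 0` a.e. outside `(-1,1)`. -/
def memX' (u : ℝ → ℝ) : Prop :=
  memH u ∧ ∀ᵐ x : ℝ, x ∉ Ioo (-1 : ℝ) 1 → u x = 0

/-- `λ₁ = inf {[u]² : u ∈ X', ‖u‖_{L²(-1,1)} = 1}`. -/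
def lam1' : ℝ :=
  sInf { t : ℝ | ∃ u : ℝ → ℝ, memX' u ∧ (∫ x in Ioo (-1 : ℝ) 1, (u x) ^ 2) = 1 ∧ gagSq u = t }

/-- Trudinger–Moser property on `(-1,1)` with constant `ω`. -/
def TMprop' (ω : ℝ) : Prop :=
  ∀ α : ℝ, 0 < α → α < 2 * π * ω →
    ∃ K : ℝ, 0 < K ∧ ∀ u : ℝ → ℝ, memX' u → gagNorm u ≤ 1 →
      (∫⁻ x in Ioo (-1 : ℝ) 1, ENNReal.ofReal (exp (α * (u x) ^ 2))) ≤ ENNReal.ofReal K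

/-- The primitive `F(t) = ∫₀ᵗ f(τ) dτ`. -/
def primF (f : ℝ → ℝ) : ℝ → ℝ := fun t => ∫ τ in (0 : ℝ)..t, f τ

/-- Hypotheses (H), with `λ₁` the Poincaré constant of `X'`. -/
def HypH (f : ℝ → ℝ) : Prop :=
  Continuous f ∧ f 0 = 0 ∧
  (∃ t₀ > (0 : ℝ), ∃ M > (0 : ℝ),
    ∀ t : ℝ, t₀ ≤ |t| → 0 < primF f t ∧ primF f t ≤ M * |f t|) ∧
  (∀ t : ℝ, t ≠ 0 → 0 < 2 * primF f t ∧ 2 * primF f t ≤ f t * t) ∧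
  (Filter.limsup (fun t => primF f t / t ^ 2) (𝓝[≠] (0 : ℝ)) < lam1' / (4 * π)) ∧
  (∀ α : ℝ, 0 < α →
    Filter.Tendsto (fun t => |f t| * exp (-α * t ^ 2)) (Filter.cocompact ℝ) (𝓝 0))

/-- `u` is a weak solution of `(-Δ)^{1/2} u = f(u)` in `(-1,1)`, `u = 0` outside. -/
def IsWeakSolution' (f u : ℝ → ℝ) : Prop :=
  memX' u ∧ ∀ v : ℝ → ℝ, memX' v →
    IntegrableOn (fun x => f (u x) * v x) (Ioo (-1 : ℝ) 1) ∧
    innerX u v / (2 * π) = ∫ x in Ioo (-1 : ℝ) 1, f (u x) * v x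



def dK (u : ℝ → ℝ) : ℝ × ℝ → ℝ := fun p => (u p.1 - u p.2) / |p.1 - p.2|

lemma innerKer_eq (u v : ℝ → ℝ) : innerKer u v = fun p => dK u p * dK v p := by
  funext p; simp only [innerKer, dK]; rw [div_mul_div_comm, sq]

lemma gagKer_eq (u : ℝ → ℝ) : gagKer u = fun p => dK u p ^ 2 := by
  funext p; simp only [gagKer, dK]; rw [div_pow]

lemma gagKer_nonneg (u : ℝ → ℝ) (p : ℝ × ℝ) : 0 ≤ gagKer u p := by
  rw [gagKer_eq]; positivity

lemma measurable_dK {u : ℝ → ℝ} (hu : Measurable u) : Measurable (dK u) := by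
  unfold dK; fun_prop

lemma measurable_gagKer {u : ℝ → ℝ} (hu : Measurable u) : Measurable (gagKer u) := by
  rw [gagKer_eq]; exact (measurable_dK hu).pow_const 2

lemma memX'.meas {u : ℝ → ℝ} (hu : memX' u) : Measurable u := hu.1.1
lemma memX'.sqi {u : ℝ → ℝ} (hu : memX' u) : Integrable (fun x => (u x) ^ 2) := hu.1.2.1
lemma memX'.gi {u : ℝ → ℝ} (hu : memX' u) : Integrable (gagKer u) := hu.1.2.2
lemma memX'.off {u : ℝ → ℝ} (hu : memX' u) : ∀ᵐ x : ℝ, x ∉ Ioo (-1 : ℝ) 1 → u x = 0 := hu.2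
lemma memX'.memLp {u : ℝ → ℝ} (hu : memX' u) : MemLp u 2 volume :=
  (memLp_two_iff_integrable_sq hu.meas.aestronglyMeasurable).2 hu.sqi
lemma memX'.dLp {u : ℝ → ℝ} (hu : memX' u) : MemLp (dK u) 2 volume := by
  refine (memLp_two_iff_integrable_sq (measurable_dK hu.meas).aestronglyMeasurable).2 ?_
  have := hu.gi
  rwa [gagKer_eq] at this

lemma memX'.ii {u v : ℝ → ℝ} (hu : memX' u) (hv : memX' v) : Integrable (innerKer u v) := by
  rw [innerKer_eq]; exact hu.dLp.integrable_mul hv.dLp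

lemma memX'.mi {u v : ℝ → ℝ} (hu : memX' u) (hv : memX' v) : Integrable (fun x => u x * v x) :=
  hu.memLp.integrable_mul hv.memLp

lemma memX'_mk {u : ℝ → ℝ} (h : Measurable u) (h2 : MemLp u 2 volume) (hd : MemLp (dK u) 2 volume)
    (h0 : ∀ᵐ x : ℝ, x ∉ Ioo (-1 : ℝ) 1 → u x = 0) : memX' u := by
  refine ⟨⟨h, h2.integrable_sq, ?_⟩, h0⟩
  rw [gagKer_eq]; exact hd.integrable_sq

lemma dK_add (u v : ℝ → ℝ) : dK (fun x => u x + v x) = dK u + dK v := by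
  funext p; simp only [dK, Pi.add_apply]; ring
lemma dK_smul (c : ℝ) (u : ℝ → ℝ) : dK (fun x => c * u x) = c • dK u := by
  funext p; simp only [dK, Pi.smul_apply, smul_eq_mul]; ring

lemma memX'.add {u v : ℝ → ℝ} (hu : memX' u) (hv : memX' v) : memX' (fun x => u x + v x) := by
  refine memX'_mk (hu.meas.add hv.meas) (hu.memLp.add hv.memLp) ?_ ?_
  · rw [dK_add]; exact hu.dLp.add hv.dLp
  · filter_upwards [hu.off, hv.off] with x h1 h2 h
    rw [h1 h, h2 h, add_zero]

lemma memX'.smul {u : ℝ → ℝ} (c : ℝ) (hu : memX' u) : memX' (fun x => c * u x) := by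
  refine memX'_mk (hu.meas.const_mul c) (hu.memLp.const_mul c) ?_ ?_
  · rw [dK_smul]; exact hu.dLp.const_smul c
  · filter_upwards [hu.off] with x h1 h
    rw [h1 h, mul_zero]

lemma memX'.sub {u v : ℝ → ℝ} (hu : memX' u) (hv : memX' v) : memX' (fun x => u x - v x) := by
  have := hu.add (hv.smul (-1))
  convert this using 2; ring

lemma memX'_zero : memX' (fun _ => 0) := by
  refine memX'_mk measurable_const (by simp) ?_ (by simp)
  have : dK (fun _ => 0) = 0 := by funext p; simp [dK]
  rw [this]; simp

/-- domination criterion -/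
lemma memX'.dom {u v : ℝ → ℝ} (hu : memX' u) (hv : Measurable v)
    (h1 : ∀ x y, |v x - v y| ≤ |u x - u y|) (h0 : ∀ x, |v x| ≤ |u x|) : memX' v := by
  refine memX'_mk hv ?_ ?_ ?_
  · exact hu.memLp.mono hv.aestronglyMeasurable (ae_of_all _ fun x => by simpa using h0 x)
  · refine hu.dLp.mono (measurable_dK hv).aestronglyMeasurable (ae_of_all _ fun p => ?_)
    simp only [dK, norm_eq_abs, abs_div]
    exact div_le_div_of_nonneg_right (h1 _ _) (abs_nonneg _)
  · filter_upwards [hu.off] with x h h'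
    have := h0 x
    rw [h h'] at this
    simpa using this

lemma ae_prod_of_ae {P : ℝ → Prop} (h : ∀ᵐ x : ℝ, P x) : ∀ᵐ p : ℝ × ℝ, P p.1 ∧ P p.2 := by
  have h1 : ∀ᵐ p : ℝ × ℝ, P p.1 := Measure.quasiMeasurePreserving_fst.ae h
  have h2 : ∀ᵐ p : ℝ × ℝ, P p.2 := Measure.quasiMeasurePreserving_snd.ae h
  exact h1.and h2

lemma dK_congr {u v : ℝ → ℝ} (h : u =ᵐ[volume] v) : dK u =ᵐ[volume] dK v := by
  filter_upwards [ae_prod_of_ae h] with p hp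
  simp only [dK, hp.1, hp.2]

lemma memX'.congr {u v : ℝ → ℝ} (hu : memX' u) (hv : Measurable v) (h : u =ᵐ[volume] v) :
    memX' v := by
  refine memX'_mk hv (hu.memLp.ae_eq h) (hu.dLp.ae_eq (dK_congr h)) ?_
  filter_upwards [hu.off, h] with x h1 h2 h3
  rw [← h2, h1 h3]

lemma innerX_congr {u u' v v' : ℝ → ℝ} (h : u =ᵐ[volume] u') (h' : v =ᵐ[volume] v') :
    innerX u v = innerX u' v' := by
  unfold innerX
  rw [innerKer_eq, innerKer_eq]
  refine integral_congr_ae ?_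
  filter_upwards [dK_congr h, dK_congr h'] with p h1 h2
  rw [h1, h2]

lemma gagSq_eq (u : ℝ → ℝ) : gagSq u = innerX u u := by
  unfold gagSq innerX; rw [innerKer_eq, gagKer_eq]; simp only [sq]

lemma gagSq_nonneg (u : ℝ → ℝ) : 0 ≤ gagSq u := integral_nonneg (gagKer_nonneg u)

lemma innerX_comm (u v : ℝ → ℝ) : innerX u v = innerX v u := by
  unfold innerX; rw [innerKer_eq, innerKer_eq]; simp only [mul_comm]

lemma innerX_add_left {u v w : ℝ → ℝ} (hu : memX' u) (hv : memX' v) (hw : memX' w) :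
    innerX (fun x => u x + v x) w = innerX u w + innerX v w := by
  unfold innerX
  rw [← integral_add (hu.ii hw) (hv.ii hw)]
  simp only [innerKer_eq, dK_add, Pi.add_apply, add_mul]

lemma innerX_smul_left (c : ℝ) (u w : ℝ → ℝ) :
    innerX (fun x => c * u x) w = c * innerX u w := by
  unfold innerX
  rw [← integral_const_mul]
  simp only [innerKer_eq, dK_smul, Pi.smul_apply, smul_eq_mul, mul_assoc]

lemma innerX_add_right {u v w : ℝ → ℝ} (hu : memX' u) (hv : memX' v) (hw : memX' w) :
    innerX w (fun x => u x + v x) = innerX w u + innerX w v := by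
  rw [innerX_comm, innerX_add_left hu hv hw, innerX_comm, innerX_comm v]

lemma innerX_smul_right (c : ℝ) (u w : ℝ → ℝ) :
    innerX w (fun x => c * u x) = c * innerX w u := by
  rw [innerX_comm, innerX_smul_left, innerX_comm]

lemma innerX_sub_left {u v w : ℝ → ℝ} (hu : memX' u) (hv : memX' v) (hw : memX' w) :
    innerX (fun x => u x - v x) w = innerX u w - innerX v w := by
  have : (fun x => u x - v x) = fun x => u x + (-1) * v x := by funext x; ring
  rw [this, innerX_add_left hu (hv.smul _) hw, innerX_smul_left]; ring

lemma innerX_sub_right {u v w : ℝ → ℝ} (hu : memX' u) (hv : memX' v) (hw : memX' w) :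
    innerX w (fun x => u x - v x) = innerX w u - innerX w v := by
  rw [innerX_comm, innerX_sub_left hu hv hw, innerX_comm, innerX_comm v]

lemma gagSq_smul (c : ℝ) (u : ℝ → ℝ) : gagSq (fun x => c * u x) = c ^ 2 * gagSq u := by
  rw [gagSq_eq, innerX_smul_left, innerX_smul_right, gagSq_eq]; ring

lemma set_int_eq {v : ℝ → ℝ} (hv : ∀ᵐ x : ℝ, x ∉ Ioo (-1 : ℝ) 1 → v x = 0) (h : ℝ → ℝ) :
    ∫ x in Ioo (-1 : ℝ) 1, h x * v x = ∫ x, h x * v x := by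
  refine setIntegral_eq_integral_of_ae_compl_eq_zero ?_
  filter_upwards [hv] with x h1 h2
  rw [h1 h2, mul_zero]

lemma set_int_sq {v : ℝ → ℝ} (hv : memX' v) :
    ∫ x in Ioo (-1 : ℝ) 1, v x ^ 2 = ∫ x, v x ^ 2 := by
  have := set_int_eq hv.off v
  simpa only [sq] using this

lemma poinc {u : ℝ → ℝ} (hu : memX' u) :
    lam1' * ∫ x in Ioo (-1 : ℝ) 1, u x ^ 2 ≤ gagSq u := by
  set s := ∫ x in Ioo (-1 : ℝ) 1, u x ^ 2 with hs
  have hs0 : 0 ≤ s := integral_nonneg fun x => by positivity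
  rcases hs0.eq_or_lt with h | h
  · rw [← h, mul_zero]; exact gagSq_nonneg u
  have hb : BddBelow { t : ℝ | ∃ u : ℝ → ℝ, memX' u ∧
      (∫ x in Ioo (-1 : ℝ) 1, (u x) ^ 2) = 1 ∧ gagSq u = t } := by
    refine ⟨0, ?_⟩
    rintro t ⟨v, -, -, rfl⟩
    exact gagSq_nonneg v
  have key : lam1' ≤ gagSq (fun x => (√s)⁻¹ * u x) := by
    refine csInf_le hb ⟨_, hu.smul _, ?_, rfl⟩
    simp only [mul_pow]
    rw [integral_const_mul, ← hs, inv_pow, Real.sq_sqrt hs0, inv_mul_cancel₀ h.ne']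
  rw [gagSq_smul, inv_pow, Real.sq_sqrt hs0] at key
  calc lam1' * s ≤ s⁻¹ * gagSq u * s := by gcongr
    _ = gagSq u := by field_simp

lemma exists_of_lam1 (hl : 0 < lam1') : ∃ u : ℝ → ℝ, memX' u ∧
      (∫ x in Ioo (-1 : ℝ) 1, (u x) ^ 2) = 1 := by
  by_contra! hcon
  have : lam1' = 0 := by
    unfold lam1'
    convert Real.sInf_empty
    ext t
    simp only [Set.mem_ofPred_eq, mem_empty_iff_false, iff_false, not_exists]
    rintro u ⟨h1, h2, -⟩
    exact hcon u h1 h2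
  linarith


lemma fatou_int {α : Type*} [MeasurableSpace α] {μ : Measure α} {h : ℕ → α → ℝ} {g : α → ℝ} {C : ℝ}
    (hC : 0 ≤ C)
    (hm : ∀ n, Measurable (h n)) (hg : Measurable g) (h0 : ∀ n x, 0 ≤ h n x)
    (hi : ∀ n, Integrable (h n) μ) (hb : ∀ n, ∫ x, h n x ∂μ ≤ C)
    (hlim : ∀ᵐ x ∂μ, Tendsto (fun n => h n x) atTop (𝓝 (g x))) :
    Integrable g μ ∧ ∫ x, g x ∂μ ≤ C := by
  have hg0 : 0 ≤ᵐ[μ] g := by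
    filter_upwards [hlim] with x hx
    exact ge_of_tendsto' hx fun n => h0 n x
  have key : ∫⁻ x, ENNReal.ofReal (g x) ∂μ ≤ ENNReal.ofReal C := by
    calc ∫⁻ x, ENNReal.ofReal (g x) ∂μ
        = ∫⁻ x, liminf (fun n => ENNReal.ofReal (h n x)) atTop ∂μ := by
          refine lintegral_congr_ae ?_
          filter_upwards [hlim] with x hx
          exact ((ENNReal.continuous_ofReal.tendsto _).comp hx).liminf_eq.symm
      _ ≤ liminf (fun n => ∫⁻ x, ENNReal.ofReal (h n x) ∂μ) atTop :=
          lintegral_liminf_le fun n => (hm n).ennreal_ofReal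
      _ ≤ ENNReal.ofReal C := by
          refine liminf_le_of_le (by isBoundedDefault) ?_
          intro b hb'
          obtain ⟨n, hn⟩ := hb'.exists
          refine hn.trans ?_
          rw [← ofReal_integral_eq_lintegral_ofReal (hi n) (ae_of_all _ (h0 n))]
          exact ENNReal.ofReal_le_ofReal (hb n)
  have hgi : Integrable g μ := by
    refine ⟨hg.aestronglyMeasurable, ?_⟩
    rw [hasFiniteIntegral_iff_ofReal hg0]
    exact key.trans_lt ENNReal.ofReal_lt_top
  refine ⟨hgi, ?_⟩
  rw [← ofReal_integral_eq_lintegral_ofReal hgi hg0] at key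
  exact (ENNReal.ofReal_le_ofReal_iff hC).1 key

/-- bounded in `L²` and a.e. convergent implies weakly convergent -/
lemma weak_lim {α : Type*} [MeasurableSpace α] {μ : Measure α} {h : ℕ → α → ℝ} {g φ : α → ℝ} {C : ℝ}
    (hC : 0 ≤ C)
    (hm : ∀ n, Measurable (h n)) (hg : Measurable g) (hφ : Measurable φ)
    (hi : ∀ n, Integrable (fun x => h n x ^ 2) μ) (hb : ∀ n, ∫ x, h n x ^ 2 ∂μ ≤ C)
    (hlim : ∀ᵐ x ∂μ, Tendsto (fun n => h n x) atTop (𝓝 (g x)))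
    (hφi : Integrable (fun x => φ x ^ 2) μ) :
    Tendsto (fun n => ∫ x, h n x * φ x ∂μ) atTop (𝓝 (∫ x, g x * φ x ∂μ)) := by
  have hgi := fatou_int (g := fun x => g x ^ 2) hC (fun n => (hm n).pow_const 2) (hg.pow_const 2)
    (fun n x => sq_nonneg _) hi hb (by filter_upwards [hlim] with x hx using hx.pow 2)
  have hφL : MemLp φ 2 μ := (memLp_two_iff_integrable_sq hφ.aestronglyMeasurable).2 hφi
  have hgL : MemLp g 2 μ := (memLp_two_iff_integrable_sq hg.aestronglyMeasurable).2 hgi.1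
  have hhL : ∀ n, MemLp (h n) 2 μ :=
    fun n => (memLp_two_iff_integrable_sq (hm n).aestronglyMeasurable).2 (hi n)
  set d : ℕ → α → ℝ := fun n x => h n x - g x with hd
  have hdL : ∀ n, MemLp (d n) 2 μ := fun n => (hhL n).sub hgL
  have hdm : ∀ n, Measurable (d n) := fun n => (hm n).sub hg
  have hdb : ∀ n, ∫ x, d n x ^ 2 ∂μ ≤ 4 * C := by
    intro n
    calc ∫ x, d n x ^ 2 ∂μ ≤ ∫ x, (2 * h n x ^ 2 + 2 * g x ^ 2) ∂μ := by
          refine integral_mono (hdL n).integrable_sq (((hi n).const_mul 2).add (hgi.1.const_mul 2)) ?_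
          intro x
          simp only [hd]
          nlinarith [sq_nonneg (h n x + g x)]
      _ = 2 * ∫ x, h n x ^ 2 ∂μ + 2 * ∫ x, g x ^ 2 ∂μ := by
          rw [integral_add ((hi n).const_mul 2) (hgi.1.const_mul 2), integral_const_mul,
            integral_const_mul]
      _ ≤ 4 * C := by linarith [hb n, hgi.2]
  have h1 : ∀ k : ℝ, 0 < k → Tendsto (fun n => ∫ x, min |d n x| (k * |φ x|) * |φ x| ∂μ) atTop (𝓝 0) := by
    intro k hk
    have : (0 : ℝ) = ∫ x, (0 : ℝ) ∂μ := by simp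
    rw [this]
    refine tendsto_integral_of_dominated_convergence (fun x => k * φ x ^ 2) ?_ (hφi.const_mul k) ?_ ?_
    · intro n
      exact (((hdm n).abs.min (hφ.abs.const_mul k)).mul hφ.abs).aestronglyMeasurable
    · intro n
      refine ae_of_all _ fun x => ?_
      rw [norm_eq_abs, abs_mul, abs_abs, abs_of_nonneg (by positivity)]
      calc min |d n x| (k * |φ x|) * |φ x| ≤ (k * |φ x|) * |φ x| := by
            gcongr; exact min_le_right _ _
        _ = k * φ x ^ 2 := by rw [mul_assoc, abs_mul_abs_self, sq]
    · filter_upwards [hlim] with x hx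
      have hdx : Tendsto (fun n => |d n x|) atTop (𝓝 0) := by
        have := (hx.sub_const (g x)).abs
        simpa [hd] using this
      have h2 : Tendsto (fun n => |d n x| * |φ x|) atTop (𝓝 0) := by
        simpa using hdx.mul_const |φ x|
      refine squeeze_zero (fun n => by positivity) (fun n => ?_) h2
      gcongr
      exact min_le_left _ _
  rw [Metric.tendsto_atTop]
  intro ε hε
  set k : ℝ := (8 * C + 1) / ε with hk
  have hk0 : 0 < k := by positivity
  obtain ⟨N, hN⟩ := (Metric.tendsto_atTop.1 (h1 k hk0)) (ε / 2) (by positivity)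
  refine ⟨N, fun n hn => ?_⟩
  have h3 := hN n hn
  rw [dist_zero_right, norm_eq_abs] at h3
  have h3' := (le_abs_self _).trans_lt h3
  rw [dist_eq_norm, ← integral_sub (f := fun x => h n x * φ x) (g := fun x => g x * φ x)
    ((hhL n).integrable_mul hφL) (hgL.integrable_mul hφL)]
  have hmini : Integrable (fun x => min |d n x| (k * |φ x|) * |φ x|) μ := by
    refine (hφi.const_mul k).mono' (((hdm n).abs.min (hφ.abs.const_mul k)).mul hφ.abs).aestronglyMeasurable
      (ae_of_all _ fun x => ?_)
    rw [norm_eq_abs, abs_mul, abs_abs, abs_of_nonneg (by positivity)]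
    calc min |d n x| (k * |φ x|) * |φ x| ≤ (k * |φ x|) * |φ x| := by
            gcongr; exact min_le_right _ _
        _ = k * φ x ^ 2 := by rw [mul_assoc, abs_mul_abs_self, sq]
  calc ‖∫ x, (h n x * φ x - g x * φ x) ∂μ‖
      ≤ ∫ x, (min |d n x| (k * |φ x|) * |φ x| + d n x ^ 2 / k) ∂μ := by
        refine norm_integral_le_of_norm_le (hmini.add ((hdL n).integrable_sq.div_const k))
          (ae_of_all _ fun x => ?_)
        rw [← sub_mul, norm_eq_abs, abs_mul]
        change |d n x| * |φ x| ≤ _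
        rcases le_total |d n x| (k * |φ x|) with h | h
        · rw [min_eq_left h]
          have : 0 ≤ d n x ^ 2 / k := by positivity
          linarith
        · have h4 : |d n x| * |φ x| ≤ d n x ^ 2 / k := by
            rw [le_div_iff₀ hk0, ← sq_abs (d n x)]
            nlinarith [abs_nonneg (d n x)]
          have : 0 ≤ min |d n x| (k * |φ x|) * |φ x| := by positivity
          linarith
    _ = (∫ x, min |d n x| (k * |φ x|) * |φ x| ∂μ) + (∫ x, d n x ^ 2 ∂μ) / k := by
        rw [integral_add hmini ((hdL n).integrable_sq.div_const k), integral_div]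
    _ < ε := by
        have : (∫ x, d n x ^ 2 ∂μ) / k ≤ ε / 2 := by
          rw [div_le_iff₀ hk0, hk]
          have := hdb n
          field_simp
          linarith
        linarith


abbrev ZZ := WithLp 2 (Lp ℝ 2 (volume : Measure ℝ) × Lp ℝ 2 (volume : Measure (ℝ × ℝ)))

def XS (c : ℝ) : Submodule ℝ ZZ where
  carrier := {z | (∀ᵐ x : ℝ, x ∉ Ioo (-1 : ℝ) 1 → z.fst x = 0) ∧
    (⇑z.snd =ᵐ[volume] fun p => c * dK z.fst p)}
  zero_mem' := by
    refine ⟨?_, ?_⟩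
    · filter_upwards [Lp.coeFn_zero ℝ 2 (volume : Measure ℝ)] with x hx _
      simp
    · have h1 : ⇑((0 : ZZ).fst) =ᵐ[volume] (fun _ => 0) := Lp.coeFn_zero ℝ 2 (volume : Measure ℝ)
      filter_upwards [Lp.coeFn_zero ℝ 2 (volume : Measure (ℝ × ℝ)), dK_congr h1] with p hp h2
      rw [h2]
      simp [dK]
  add_mem' := by
    rintro z w ⟨hz1, hz2⟩ ⟨hw1, hw2⟩
    have h1 : ⇑((z + w).fst) =ᵐ[volume] fun x => z.fst x + w.fst x :=
      Lp.coeFn_add z.fst w.fst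
    have h2 : ⇑((z + w).snd) =ᵐ[volume] fun x => z.snd x + w.snd x :=
      Lp.coeFn_add z.snd w.snd
    refine ⟨?_, ?_⟩
    · filter_upwards [h1, hz1, hw1] with x a b d h
      rw [a, b h, d h, add_zero]
    · filter_upwards [h2, dK_congr h1, hz2, hw2] with p a b d e
      rw [a, b, d, e, dK_add, Pi.add_apply]; ring
  smul_mem' := by
    rintro r z ⟨hz1, hz2⟩
    have h1 : ⇑((r • z).fst) =ᵐ[volume] fun x => r * z.fst x :=
      Lp.coeFn_smul r z.fst
    have h2 : ⇑((r • z).snd) =ᵐ[volume] fun x => r * z.snd x :=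
      Lp.coeFn_smul r z.snd
    refine ⟨?_, ?_⟩
    · filter_upwards [h1, hz1] with x a b h
      rw [a, b h, mul_zero]
    · filter_upwards [h2, dK_congr h1, hz2] with p a b d
      rw [a, b, d, dK_smul, Pi.smul_apply, smul_eq_mul]; ring

lemma XS_closed (c : ℝ) : IsClosed (XS c : Set ZZ) := by
  refine IsSeqClosed.isClosed ?_
  intro z w hz hlim
  have h1 : Tendsto (fun n => (z n).fst) atTop (𝓝 w.fst) :=
    ((WithLp.continuous_fst 2 _ _).tendsto w).comp hlim
  have h2 : Tendsto (fun n => (z n).snd) atTop (𝓝 w.snd) :=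
    ((WithLp.continuous_snd 2 _ _).tendsto w).comp hlim
  obtain ⟨φ, hφ, hφ'⟩ := (tendstoInMeasure_of_tendsto_Lp h1).exists_seq_tendsto_ae
  obtain ⟨ψ, hψ, hψ'⟩ := (tendstoInMeasure_of_tendsto_Lp
    (h2.comp hφ.tendsto_atTop)).exists_seq_tendsto_ae
  have hz1 := fun n => (hz n).1
  have hz2 := fun n => (hz n).2
  refine ⟨?_, ?_⟩
  · filter_upwards [hφ', ae_all_iff.2 hz1] with x hx h h'
    refine tendsto_nhds_unique hx ?_
    simp only [fun n => h n h', tendsto_const_nhds_iff]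
  · filter_upwards [hψ', ae_prod_of_ae hφ', ae_all_iff.2 hz2] with p hp h h'
    refine tendsto_nhds_unique hp ?_
    simp only [Function.comp, h', dK]
    have a := (h.1.comp hψ.tendsto_atTop)
    have b := (h.2.comp hψ.tendsto_atTop)
    exact ((a.sub b).div_const _).const_mul c

lemma resolvent_exists {h : ℝ → ℝ} (hh : MemLp h 2 volume) {L : ℝ} (hL : 0 < L) :
    ∃ w, memX' w ∧ ∀ v, memX' v → innerX w v / (2 * π) + L * ∫ x, w x * v x = ∫ x, h x * v x := by
  set c : ℝ := (√(2 * π * L))⁻¹ with hc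
  have hcs : c * c = (2 * π * L)⁻¹ := by
    rw [hc, ← mul_inv, Real.mul_self_sqrt (by positivity)]
  have hc0 : 0 < c := by positivity
  have : CompleteSpace (XS c) := (XS_closed c).completeSpace_coe
  let z0 : ZZ := WithLp.toLp 2 (hh.toLp h, 0)
  let z := (XS c).starProjection z0
  have hz : z ∈ XS c := Submodule.starProjection_apply_mem _ _
  have hwm : Measurable (z.fst : ℝ → ℝ) := (Lp.stronglyMeasurable z.fst).measurable
  have hd : MemLp (dK z.fst) 2 volume := by
    have h1 : MemLp (fun p => c⁻¹ * z.snd p) 2 volume := (Lp.memLp z.snd).const_mul _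
    refine h1.ae_eq ?_
    filter_upwards [hz.2] with p hp
    rw [hp]; field_simp
  have hw : memX' z.fst := memX'_mk hwm (Lp.memLp _) hd hz.1
  refine ⟨fun x => L⁻¹ * z.fst x, hw.smul _, fun v hv => ?_⟩
  let y : ZZ := WithLp.toLp 2 (hv.memLp.toLp v, (hv.dLp.const_mul c).toLp _)
  have hy1 : ⇑y.fst =ᵐ[volume] v := hv.memLp.coeFn_toLp
  have hy2 : ⇑y.snd =ᵐ[volume] fun p => c * dK v p := (hv.dLp.const_mul c).coeFn_toLp
  have hy : y ∈ XS c := by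
    refine ⟨?_, ?_⟩
    · filter_upwards [hy1, hv.off] with x a b h
      rw [a, b h]
    · filter_upwards [hy2, dK_congr hy1] with p a b
      rw [a, b]
  have key := (XS c).starProjection_inner_eq_zero z0 y hy
  rw [inner_sub_left, sub_eq_zero, WithLp.prod_inner_apply, WithLp.prod_inner_apply] at key
  have e1 : inner ℝ z0.fst y.fst = ∫ x, h x * v x := by
    rw [L2.inner_def]
    refine integral_congr_ae ?_
    filter_upwards [hy1, hh.coeFn_toLp] with x a b
    have b' : z0.fst x = h x := b
    rw [a, b']; simp [mul_comm]
  have e2 : inner ℝ z0.snd y.snd = 0 := by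
    change inner ℝ (0 : Lp ℝ 2 (volume : Measure (ℝ × ℝ))) y.snd = 0
    simp
  have e3 : inner ℝ z.fst y.fst = ∫ x, z.fst x * v x := by
    rw [L2.inner_def]
    refine integral_congr_ae ?_
    filter_upwards [hy1] with x a
    rw [a]; simp [mul_comm]
  have e4 : inner ℝ z.snd y.snd = (2 * π * L)⁻¹ * innerX z.fst v := by
    rw [L2.inner_def]
    unfold innerX
    rw [← integral_const_mul, innerKer_eq]
    refine integral_congr_ae ?_
    filter_upwards [hy2, hz.2] with p a b
    rw [a, b, ← hcs]
    simp
    ring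
  change inner ℝ z0.fst y.fst + inner ℝ z0.snd y.snd = inner ℝ z.fst y.fst + inner ℝ z.snd y.snd at key
  rw [e1, e2, e3, e4] at key
  rw [innerX_smul_left]
  simp only [mul_assoc]
  rw [integral_const_mul]
  rw [add_zero] at key
  rw [key]
  field_simp
  ring


lemma sig_mp (a : ℝ) : MeasurePreserving (fun x : ℝ => 2 * a - x) volume volume :=
  Measure.measurePreserving_sub_left volume (2 * a)

lemma mp_integral {α : Type*} [MeasurableSpace α] {μ : Measure α} {T : α → α}
    (hT : MeasurePreserving T μ μ) {G : α → ℝ} (hG : AEStronglyMeasurable G μ) :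
    ∫ x, G (T x) ∂μ = ∫ x, G x ∂μ := by
  conv_rhs => rw [← hT.map_eq]
  rw [integral_map hT.measurable.aemeasurable (by rw [hT.map_eq]; exact hG)]

lemma sym2_int {a : ℝ} {G H : ℝ → ℝ} (hG : Integrable G)
    (h : ∀ x, G x + G (2 * a - x) = H x) : ∫ x, G x = (∫ x, H x) / 2 := by
  have i1 : Integrable (fun x => G (2 * a - x)) :=
    (sig_mp a).integrable_comp_of_integrable hG
  have e1 : ∫ x, G (2 * a - x) = ∫ x, G x := mp_integral (sig_mp a) hG.aestronglyMeasurable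
  have e2 : ∫ x, H x = (∫ x, G x) + ∫ x, G (2 * a - x) := by
    rw [← integral_add hG i1]
    exact integral_congr_ae (ae_of_all _ fun x => (h x).symm)
  rw [e2, e1]; ring

lemma sym4_int {a : ℝ} {G : ℝ × ℝ → ℝ} (hG : Integrable G)
    (h : ∀ x y, G (x, y) + G (2 * a - x, 2 * a - y) + G (2 * a - x, y) + G (x, 2 * a - y) ≤ 0) :
    ∫ p, G p ≤ 0 := by
  have m1 : MeasurePreserving (fun p : ℝ × ℝ => (2 * a - p.1, 2 * a - p.2)) volume volume :=
    (sig_mp a).prod (sig_mp a)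
  have m2 : MeasurePreserving (fun p : ℝ × ℝ => (2 * a - p.1, p.2)) volume volume :=
    (sig_mp a).prod (MeasurePreserving.id volume)
  have m3 : MeasurePreserving (fun p : ℝ × ℝ => (p.1, 2 * a - p.2)) volume volume :=
    (MeasurePreserving.id volume).prod (sig_mp a)
  have i1 : Integrable (fun p : ℝ × ℝ => G (2 * a - p.1, 2 * a - p.2)) := m1.integrable_comp_of_integrable hG
  have i2 : Integrable (fun p : ℝ × ℝ => G (2 * a - p.1, p.2)) := m2.integrable_comp_of_integrable hG
  have i3 : Integrable (fun p : ℝ × ℝ => G (p.1, 2 * a - p.2)) := m3.integrable_comp_of_integrable hG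
  have e1 := mp_integral m1 hG.aestronglyMeasurable
  have e2 := mp_integral m2 hG.aestronglyMeasurable
  have e3 := mp_integral m3 hG.aestronglyMeasurable
  have key : ∫ p : ℝ × ℝ, (G p + G (2 * a - p.1, 2 * a - p.2) + G (2 * a - p.1, p.2)
      + G (p.1, 2 * a - p.2)) ≤ 0 := integral_nonpos fun p => h p.1 p.2
  have s2 : ∫ p : ℝ × ℝ, (G p + G (2 * a - p.1, 2 * a - p.2) + G (2 * a - p.1, p.2)
      + G (p.1, 2 * a - p.2)) = (∫ p : ℝ × ℝ, G p) + (∫ p : ℝ × ℝ, G (2 * a - p.1, 2 * a - p.2))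
      + (∫ p : ℝ × ℝ, G (2 * a - p.1, p.2)) + ∫ p : ℝ × ℝ, G (p.1, 2 * a - p.2) := by
    rw [integral_add, integral_add, integral_add hG i1]
    all_goals first | exact hG | exact i1 | exact i2 | exact i3 | exact hG.add i1 | exact (hG.add i1).add i2
  rw [s2, e1, e2, e3] at key
  linarith

lemma innerX_odd {a : ℝ} {w ψ : ℝ → ℝ} (hw : memX' w) (hψ : memX' ψ)
    (hodd : ∀ x, ψ (2 * a - x) = - ψ x)
    (hk : ∀ x y, ((w x - w (2 * a - x)) - (w y - w (2 * a - y))) * (ψ x - ψ y) / |x - y| ^ 2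
      + ((w x - w (2 * a - x)) + (w y - w (2 * a - y))) * (ψ x + ψ y) / |2 * a - x - y| ^ 2 ≤ 0) :
    innerX w ψ ≤ 0 := by
  refine sym4_int (a := a) (hw.ii hψ) fun x y => ?_
  refine le_trans (le_of_eq ?_) (hk x y)
  simp only [innerKer, hodd]
  have e1 : |2 * a - x - (2 * a - y)| = |x - y| := by rw [← abs_neg]; congr 1; ring
  have e2 : |x - (2 * a - y)| = |2 * a - x - y| := by rw [← abs_neg]; congr 1; ring
  rw [e1, e2]
  ring

lemma odd_test {a L : ℝ} (hL : 0 < L) {w ψ h : ℝ → ℝ} (hh : MemLp h 2 volume)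
    (hw : memX' w) (hψ : memX' ψ)
    (heq : innerX w ψ / (2 * π) + L * ∫ x, w x * ψ x = ∫ x, h x * ψ x)
    (hodd : ∀ x, ψ (2 * a - x) = - ψ x)
    (hk : ∀ x y, ((w x - w (2 * a - x)) - (w y - w (2 * a - y))) * (ψ x - ψ y) / |x - y| ^ 2
      + ((w x - w (2 * a - x)) + (w y - w (2 * a - y))) * (ψ x + ψ y) / |2 * a - x - y| ^ 2 ≤ 0)
    (hz : ∀ x, (w x - w (2 * a - x)) * ψ x = - ψ x ^ 2)
    (hhψ : ∀ x, 0 ≤ (h x - h (2 * a - x)) * ψ x) : ψ =ᵐ[volume] fun _ => 0 := by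
  have h1 := innerX_odd hw hψ hodd hk
  have h2 : ∫ x, w x * ψ x = (∫ x, - ψ x ^ 2) / 2 := by
    refine sym2_int (a := a) (hw.mi hψ) fun x => ?_
    rw [hodd, ← hz]; ring
  have h3 : ∫ x, h x * ψ x = (∫ x, (h x - h (2 * a - x)) * ψ x) / 2 := by
    refine sym2_int (a := a) (hh.integrable_mul hψ.memLp) fun x => ?_
    change h x * ψ x + h (2 * a - x) * ψ (2 * a - x) = _
    rw [hodd]; ring
  have h4 : 0 ≤ ∫ x, (h x - h (2 * a - x)) * ψ x := integral_nonneg hhψ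
  rw [integral_neg] at h2
  have h5 : 0 ≤ ∫ x, ψ x ^ 2 := integral_nonneg fun x => sq_nonneg _
  have h6 : innerX w ψ / (2 * π) ≤ 0 := div_nonpos_of_nonpos_of_nonneg h1 (by positivity)
  have h7 : ∫ x, ψ x ^ 2 = 0 := by
    rw [h2, h3] at heq
    have : L * (∫ x, ψ x ^ 2) ≤ 0 := by linarith
    nlinarith
  rw [integral_eq_zero_iff_of_nonneg (fun x => sq_nonneg _) hψ.sqi] at h7
  filter_upwards [h7] with x hx
  simpa using hx

lemma ker_abs (A B K K' : ℝ) (h0' : 0 ≤ K') (h0 : 0 ≤ K) (h : K' ≤ K ∨ A = B) :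
    (A - B) * (max (-A) 0 - max (-B) 0) * K + (A + B) * (max (-A) 0 + max (-B) 0) * K' ≤ 0 := by
  rcases le_total 0 A with hA | hA <;> rcases le_total 0 B with hB | hB
  · rw [max_eq_right (by linarith), max_eq_right (by linarith)]; simp
  · rw [max_eq_right (by linarith), max_eq_left (by linarith)]
    rcases h with h | h
    · have e : (A - B) * (0 - -B) * K + (A + B) * (0 + -B) * K'
          = - (-B * A * (K - K')) - (B * B * (K + K')) := by ring
      rw [e]
      have : 0 ≤ -B * A * (K - K') := mul_nonneg (mul_nonneg (by linarith) hA) (by linarith)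
      have : 0 ≤ B * B * (K + K') := mul_nonneg (mul_self_nonneg _) (by linarith)
      linarith
    · have : A = 0 := by linarith
      have : B = 0 := by linarith
      subst_vars; simp
  · rw [max_eq_left (by linarith), max_eq_right (by linarith)]
    rcases h with h | h
    · have e : (A - B) * (-A - 0) * K + (A + B) * (-A + 0) * K'
          = - (-A * B * (K - K')) - (A * A * (K + K')) := by ring
      rw [e]
      have : 0 ≤ -A * B * (K - K') := mul_nonneg (mul_nonneg (by linarith) hB) (by linarith)
      have : 0 ≤ A * A * (K + K') := mul_nonneg (mul_self_nonneg _) (by linarith)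
      linarith
    · have : A = 0 := by linarith
      have : B = 0 := by linarith
      subst_vars; simp
  · rw [max_eq_left (by linarith), max_eq_left (by linarith)]
    have e : (A - B) * (-A - -B) * K + (A + B) * (-A + -B) * K'
          = - ((A - B) ^ 2 * K) - ((A + B) ^ 2 * K') := by ring
    rw [e]
    have : 0 ≤ (A - B) ^ 2 * K := by positivity
    have : 0 ≤ (A + B) ^ 2 * K' := by positivity
    linarith

lemma res_nonneg {L : ℝ} (hL : 0 < L) {w h : ℝ → ℝ} (h0 : ∀ x, 0 ≤ h x) (hw : memX' w)
    (heq : ∀ v, memX' v → innerX w v / (2 * π) + L * ∫ x, w x * v x = ∫ x, h x * v x) :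
    ∀ᵐ x, 0 ≤ w x := by
  set v : ℝ → ℝ := fun x => max (-w x) 0 with hv
  have hvX : memX' v := by
    refine hw.dom (hw.meas.neg.max measurable_const) (fun x y => ?_) (fun x => ?_)
    · simp only [hv]
      refine (abs_max_sub_max_le_abs _ _ _).trans ?_
      rw [← abs_neg]; apply le_of_eq; congr 1; ring
    · simp only [hv]
      rw [abs_of_nonneg (le_max_right _ _)]
      exact max_le (neg_le_abs _) (abs_nonneg _)
  have e := heq v hvX
  have h1 : innerX w v ≤ 0 := by
    refine integral_nonpos fun p => ?_
    simp only [innerKer, Pi.zero_apply]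
    refine div_nonpos_of_nonpos_of_nonneg ?_ (by positivity)
    simp only [hv]
    rcases le_total (w p.1) (w p.2) with h | h
    · exact mul_nonpos_of_nonpos_of_nonneg (by linarith) (by
        have := max_le_max_right 0 (neg_le_neg h); linarith)
    · exact mul_nonpos_of_nonneg_of_nonpos (by linarith) (by
        have := max_le_max_right 0 (neg_le_neg h); linarith)
  have h2 : ∫ x, w x * v x = - ∫ x, v x ^ 2 := by
    rw [← integral_neg]
    refine integral_congr_ae (ae_of_all _ fun x => ?_)
    simp only [hv]
    rcases le_total (w x) 0 with h | h
    · rw [max_eq_left (by linarith)]; ring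
    · rw [max_eq_right (by linarith)]; ring
  have h3 : 0 ≤ ∫ x, h x * v x := integral_nonneg fun x => mul_nonneg (h0 x) (le_max_right _ _)
  have h6 : innerX w v / (2 * π) ≤ 0 := div_nonpos_of_nonpos_of_nonneg h1 (by positivity)
  have h5 : 0 ≤ ∫ x, v x ^ 2 := integral_nonneg fun x => sq_nonneg _
  have h7 : ∫ x, v x ^ 2 = 0 := by
    rw [h2] at e
    nlinarith
  rw [integral_eq_zero_iff_of_nonneg (fun x => sq_nonneg _) hvX.sqi] at h7
  filter_upwards [h7] with x hx
  have : v x = 0 := by simpa using hx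
  have h8 : -w x ≤ v x := le_max_left _ _
  linarith

lemma memX'.refl {w : ℝ → ℝ} (hw : memX' w) : memX' (fun x => w (2 * 0 - x)) := by
  have m1 : MeasurePreserving (fun p : ℝ × ℝ => (2 * 0 - p.1, 2 * 0 - p.2)) volume volume :=
    (sig_mp 0).prod (sig_mp 0)
  refine memX'_mk (hw.meas.comp (sig_mp 0).measurable) (hw.memLp.comp_measurePreserving (sig_mp 0)) ?_ ?_
  · have := hw.dLp.comp_measurePreserving m1
    refine this.congr_norm (measurable_dK (hw.meas.comp (sig_mp 0).measurable)).aestronglyMeasurable ?_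
    refine ae_of_all _ fun p => ?_
    simp only [dK, Function.comp]
    have e1 : |2 * 0 - p.1 - (2 * 0 - p.2)| = |p.1 - p.2| := by rw [← abs_neg]; congr 1; ring
    rw [e1]
  · filter_upwards [(sig_mp 0).quasiMeasurePreserving.ae hw.off] with x hx h
    apply hx
    rintro ⟨h1, h2⟩
    exact h ⟨by linarith, by linarith⟩

lemma res_even {L : ℝ} (hL : 0 < L) {w h : ℝ → ℝ} (hh : MemLp h 2 volume)
    (hd : ∀ x y, |x| ≤ |y| → h y ≤ h x) (hw : memX' w)
    (heq : ∀ v, memX' v → innerX w v / (2 * π) + L * ∫ x, w x * v x = ∫ x, h x * v x) :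
    ∀ᵐ x, w (-x) = w x := by
  have hψ : memX' (fun x => w (2 * 0 - x) - w x) := hw.refl.sub hw
  have := odd_test (a := 0) hL hh hw hψ (heq _ hψ) ?_ ?_ ?_ ?_
  · filter_upwards [this] with x hx
    simp only [mul_zero, zero_sub] at hx
    linarith
  · intro x
    simp
  · intro x y
    have h1 : ∀ t s : ℝ, 0 ≤ s → (t * (-t)) / s ≤ 0 := fun t s hs =>
      div_nonpos_of_nonpos_of_nonneg (by nlinarith [mul_self_nonneg t]) hs
    have a1 := h1 ((w x - w (2 * 0 - x)) - (w y - w (2 * 0 - y))) (|x - y| ^ 2) (by positivity)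
    have a2 := h1 ((w x - w (2 * 0 - x)) + (w y - w (2 * 0 - y))) (|2 * 0 - x - y| ^ 2) (by positivity)
    refine le_trans (le_of_eq ?_) (add_nonpos a1 a2)
    ring
  · intro x; ring
  · intro x
    have : h (2 * 0 - x) = h x := le_antisymm (hd _ _ (by simp)) (hd _ _ (by simp))
    rw [this]; simp


lemma inv_sq_le {s t : ℝ} (hs : s ≠ 0) (h : |s| ≤ |t|) : (|t| ^ 2)⁻¹ ≤ (|s| ^ 2)⁻¹ := by
  have : 0 < |s| := abs_pos.2 hs
  gcongr

lemma res_mono {L : ℝ} (hL : 0 < L) {w h : ℝ → ℝ} (hh : MemLp h 2 volume)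
    (hd : ∀ x y, |x| ≤ |y| → h y ≤ h x) (hw : memX' w) (hw0 : ∀ᵐ x, 0 ≤ w x)
    (heq : ∀ v, memX' v → innerX w v / (2 * π) + L * ∫ x, w x * v x = ∫ x, h x * v x)
    {a : ℝ} (ha : 0 ≤ a) : ∀ᵐ x, x < a → w (2 * a - x) ≤ w x := by
  set z : ℝ → ℝ := fun x => w x - w (2 * a - x) with hz
  have hzo : ∀ x, z (2 * a - x) = - z x := by
    intro x; simp only [hz]
    have : 2 * a - (2 * a - x) = x := by ring
    rw [this]; ring
  have hzm : Measurable z := hw.meas.sub (hw.meas.comp (sig_mp a).measurable)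
  set ψ : ℝ → ℝ := fun x => if x < a then max (-z x) 0 else - max (z x) 0 with hψ
  have hψm : Measurable ψ := Measurable.ite measurableSet_Iio (hzm.neg.max measurable_const)
    (hzm.max measurable_const).neg
  have p1 : ∀ x, x < a → ψ x = max (-z x) 0 := fun x hx => by simp only [hψ, if_pos hx]
  have p2 : ∀ x, a ≤ x → ψ x = - max (z x) 0 := fun x hx => by
    simp only [hψ, if_neg (not_lt.2 hx)]
  have p2' : ∀ x, a ≤ x → ψ x = - max (-z (2 * a - x)) 0 := fun x hx => by
    rw [p2 x hx, hzo, neg_neg]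
  have hodd : ∀ x, ψ (2 * a - x) = - ψ x := by
    intro x
    rcases lt_trichotomy x a with h | h | h
    · rw [p1 x h, p2 _ (by linarith), hzo]
    · have e : 2 * a - x = x := by linarith
      have : z x = 0 := by have := hzo x; rw [e] at this; linarith
      rw [e, p2 x h.ge, this]; simp
    · rw [p2 x h.le, p1 _ (by linarith), hzo]; simp
  have hzL : MemLp z 2 volume := hw.memLp.sub (hw.memLp.comp_measurePreserving (sig_mp a))
  have m1 : MeasurePreserving (fun p : ℝ × ℝ => (2 * a - p.1, 2 * a - p.2)) volume volume :=
    (sig_mp a).prod (sig_mp a)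
  have m3 : MeasurePreserving (fun p : ℝ × ℝ => (p.1, 2 * a - p.2)) volume volume :=
    (MeasurePreserving.id volume).prod (sig_mp a)
  have hdz : MemLp (dK z) 2 volume := by
    have := hw.dLp.sub (hw.dLp.comp_measurePreserving m1)
    refine this.congr_norm (measurable_dK hzm).aestronglyMeasurable (ae_of_all _ fun p => ?_)
    congr 1
    simp only [dK, hz, Function.comp, Pi.sub_apply]
    have e1 : |2 * a - p.1 - (2 * a - p.2)| = |p.1 - p.2| := by rw [← abs_neg]; congr 1; ring
    rw [e1]
    ring
  have hψX : memX' ψ := by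
    refine memX'_mk hψm ?_ ?_ ?_
    · refine hzL.mono hψm.aestronglyMeasurable (ae_of_all _ fun x => ?_)
      simp only [norm_eq_abs]
      rcases lt_or_ge x a with h | h
      · rw [p1 x h, abs_of_nonneg (le_max_right _ _)]
        exact max_le (neg_le_abs _) (abs_nonneg _)
      · rw [p2 x h, abs_neg, abs_of_nonneg (le_max_right _ _)]
        exact max_le (le_abs_self _) (abs_nonneg _)
    · have := hdz.norm.add (hdz.comp_measurePreserving m3).norm
      refine this.mono (measurable_dK hψm).aestronglyMeasurable (ae_of_all _ fun p => ?_)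
      obtain ⟨x, y⟩ := p
      simp only [Pi.add_apply, Function.comp, dK, norm_eq_abs, abs_div, abs_abs]
      have n1 : 0 ≤ |z x - z y| / |x - y| := by positivity
      have n2 : 0 ≤ |z x - z (2 * a - y)| / |x - (2 * a - y)| := by positivity
      rw [abs_of_nonneg (add_nonneg n1 n2)]
      have key : ∀ s t : ℝ, |max (-s) 0 - max (-t) 0| ≤ |s - t| := fun s t => by
        refine (abs_max_sub_max_le_abs _ _ _).trans (le_of_eq ?_)
        rw [← abs_neg]; congr 1; ring
      have key1 : ∀ s t : ℝ, |max s 0 - max t 0| ≤ |s - t| := fun s t =>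
        abs_max_sub_max_le_abs _ _ _
      have key2 : ∀ s t : ℝ, |max (-s) 0 + max t 0| ≤ |s - t| ∨
          |max (-s) 0 + max t 0| ≤ |s + t| := fun s t => by
        rw [abs_of_nonneg (by positivity)]
        rcases le_total 0 s with hs | hs <;> rcases le_total 0 t with ht | ht
        · right
          rw [max_eq_right (by linarith), max_eq_left ht, abs_of_nonneg (by linarith)]; linarith
        · left
          rw [max_eq_right (by linarith), max_eq_right ht]; simp
        · left
          rw [max_eq_left (by linarith), max_eq_left ht, abs_of_nonpos (by linarith)]; linarith
        · right
          rw [max_eq_left (by linarith), max_eq_right ht, abs_of_nonpos (by linarith)]; linarith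
      rcases lt_or_ge x a with h | h <;> rcases lt_or_ge y a with h' | h'
      · rw [p1 x h, p1 y h']
        have := div_le_div_of_nonneg_right (key (z x) (z y)) (abs_nonneg (x - y))
        linarith
      · rw [p1 x h, p2 y h', sub_neg_eq_add, hzo, sub_neg_eq_add]
        rcases key2 (z x) (z y) with k | k
        · have := div_le_div_of_nonneg_right k (abs_nonneg (x - y))
          rw [hzo, sub_neg_eq_add] at n2
          linarith
        · have hxy : |x - (2 * a - y)| ≤ |x - y| := by
            rw [abs_of_nonpos (by linarith : x - y ≤ 0)]
            exact abs_le.2 ⟨by linarith, by linarith⟩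
          rcases eq_or_ne (x - (2 * a - y)) 0 with h0 | h0
          · have : z x = - z y := by
              have : x = 2 * a - y := by linarith
              rw [this, hzo]
            rw [this] at k
            have : |max (-z x) 0 + max (z y) 0| = 0 := by
              refine le_antisymm ?_ (abs_nonneg _)
              rw [‹z x = - z y›]
              simpa using k
            rw [this, zero_div]
            rw [hzo, sub_neg_eq_add] at n2
            linarith
          · have := div_le_div₀ (abs_nonneg _) k (abs_pos.2 h0) hxy
            linarith
      · rw [p2 x h, p1 y h', hzo, sub_neg_eq_add, ← neg_add', abs_neg]
        rw [add_comm (max (z x) 0)]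
        rcases key2 (z y) (z x) with k | k
        · have := div_le_div_of_nonneg_right k (abs_nonneg (x - y))
          rw [hzo, sub_neg_eq_add] at n2
          rw [abs_sub_comm (z y)] at this
          linarith
        · have hxy : |x - (2 * a - y)| ≤ |x - y| := by
            rw [abs_of_nonneg (by linarith : 0 ≤ x - y)]
            exact abs_le.2 ⟨by linarith, by linarith⟩
          rw [add_comm (z y)] at k
          rcases eq_or_ne (x - (2 * a - y)) 0 with h0 | h0
          · have h3 : z x = - z y := by
              have : x = 2 * a - y := by linarith
              rw [this, hzo]
            have : |max (-z y) 0 + max (z x) 0| = 0 := by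
              refine le_antisymm ?_ (abs_nonneg _)
              refine k.trans ?_
              rw [h3]; simp
            rw [this, zero_div]
            rw [hzo, sub_neg_eq_add] at n2
            linarith
          · have := div_le_div₀ (abs_nonneg _) k (abs_pos.2 h0) hxy
            linarith
      · rw [p2 x h, p2 y h']
        have h1 : |-max (z x) 0 - -max (z y) 0| ≤ |z x - z y| := by
          have := key1 (z x) (z y)
          rw [← abs_neg]
          refine le_trans (le_of_eq ?_) this
          congr 1; ring
        have := div_le_div_of_nonneg_right h1 (abs_nonneg (x - y))
        linarith
    · have q := (sig_mp a).quasiMeasurePreserving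
      filter_upwards [hw.off, hw0, q.ae hw.off, q.ae hw0] with x h1 h2 h3 h4 h5
      rcases lt_or_ge x a with h | h
      · have : z x = 0 := by
          simp only [hz]
          rw [h1 h5, h3, sub_zero]
          rintro ⟨h6, h7⟩
          exact h5 ⟨by linarith, by linarith⟩
        rw [p1 x h, this]; simp
      · rw [p2 x h]
        have : z x ≤ 0 := by
          simp only [hz]
          rw [h1 h5]; linarith
        rw [max_eq_right this, neg_zero]
  have hψ0 := odd_test (a := a) hL hh hw hψX (heq _ hψX) hodd ?_ ?_ ?_
  · filter_upwards [hψ0] with x hx hxa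
    rw [p1 x hxa] at hx
    have : -z x ≤ 0 := by rw [← hx]; exact le_max_left _ _
    simp only [hz] at this
    linarith
  · intro x y
    change (z x - z y) * (ψ x - ψ y) / |x - y| ^ 2 + (z x + z y) * (ψ x + ψ y) / |2 * a - x - y| ^ 2 ≤ 0
    rw [div_eq_mul_inv, div_eq_mul_inv]
    have K0 : 0 ≤ (|x - y| ^ 2)⁻¹ := by positivity
    have K0' : 0 ≤ (|2 * a - x - y| ^ 2)⁻¹ := by positivity
    have same : (x - a) * (y - a) ≥ 0 → (|2 * a - x - y| ^ 2)⁻¹ ≤ (|x - y| ^ 2)⁻¹ ∨ x = y := by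
      intro h
      rcases eq_or_ne x y with e | e
      · exact Or.inr e
      · refine Or.inl (inv_sq_le (sub_ne_zero.2 e) (sq_le_sq.1 ?_))
        nlinarith
    have opp : (x - a) * (y - a) ≤ 0 → (|x - y| ^ 2)⁻¹ ≤ (|2 * a - x - y| ^ 2)⁻¹ ∨ x = 2 * a - y := by
      intro h
      rcases eq_or_ne x (2 * a - y) with e | e
      · exact Or.inr e
      · refine Or.inl (inv_sq_le (fun h' => e (by linarith)) (sq_le_sq.1 ?_))
        nlinarith
    rcases lt_or_ge x a with h | h <;> rcases lt_or_ge y a with h' | h'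
    · rw [p1 x h, p1 y h']
      exact ker_abs _ _ _ _ K0' K0 ((same (by nlinarith)).imp id (fun e => by rw [e]))
    · have := ker_abs (z x) (z (2 * a - y)) _ _ K0 K0' ((opp (by nlinarith)).imp id (fun e => by rw [e]))
      rw [p1 x h, p2' y h']
      rw [hzo] at this ⊢
      refine le_trans (le_of_eq ?_) this
      ring
    · have := ker_abs (z (2 * a - x)) (z y) _ _ K0 K0' ((opp (by nlinarith)).imp id
        (fun e => by rw [e]; congr 1; ring))
      rw [p2' x h, p1 y h']
      rw [hzo] at this ⊢
      refine le_trans (le_of_eq ?_) this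
      ring
    · have := ker_abs (z (2 * a - x)) (z (2 * a - y)) _ _ K0' K0 ((same (by nlinarith)).imp id
        (fun e => by rw [e]))
      rw [p2' x h, p2' y h']
      rw [hzo, hzo] at this ⊢
      refine le_trans (le_of_eq ?_) this
      ring
  · intro x
    change z x * ψ x = _
    rcases lt_or_ge x a with h | h
    · rw [p1 x h]
      rcases le_total 0 (z x) with h | h
      · rw [max_eq_right (by linarith)]; ring
      · rw [max_eq_left (by linarith)]; ring
    · rw [p2 x h]
      rcases le_total 0 (z x) with h | h
      · rw [max_eq_left (by linarith)]; ring
      · rw [max_eq_right (by linarith)]; ring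
  · intro x
    rcases lt_or_ge x a with h | h
    · rw [p1 x h]
      refine mul_nonneg (sub_nonneg.2 (hd _ _ (sq_le_sq.1 ?_))) (le_max_right _ _)
      nlinarith
    · rw [p2 x h]
      refine mul_nonneg_of_nonpos_of_nonpos (sub_nonpos.2 (hd _ _ (sq_le_sq.1 ?_))) ?_
      · nlinarith
      · simp


lemma mono_pts {w : ℝ → ℝ} (hw : memX' w) (h0 : ∀ᵐ x, 0 ≤ w x) (he : ∀ᵐ x, w (-x) = w x)
    (hm : ∀ a : ℝ, 0 ≤ a → ∀ᵐ x, x < a → w (2 * a - x) ≤ w x) :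
    ∃ E : Set ℝ, (∀ᵐ x, x ∈ E) ∧ (∀ x ∈ E, 0 ≤ w x) ∧
      ∀ x ∈ E, ∀ y ∈ E, |x| ≤ |y| → w y ≤ w x := by
  have hli : LocallyIntegrable w volume := hw.memLp.locallyIntegrable (by norm_num)
  set δ : ℕ → ℝ := fun n => 1 / ((n : ℝ) + 1) with hδ
  have hδ0 : ∀ n, 0 < δ n := fun n => by positivity
  have hδt : Tendsto δ atTop (𝓝 0) := tendsto_one_div_add_atTop_nhds_zero_nat
  have hδl : Tendsto δ atTop (𝓝[>] 0) :=
    tendsto_nhdsWithin_iff.2 ⟨hδt, Eventually.of_forall hδ0⟩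
  set P : ℝ → Prop := fun x =>
    Tendsto (fun n => ⨍ y in Metric.closedBall x (δ n), w y) atTop (𝓝 (w x)) with hP
  have hPa : ∀ᵐ x, P x := by
    filter_upwards [IsUnifLocDoublingMeasure.ae_tendsto_average (μ := volume) hli 1] with x hx
    refine hx (fun _ => x) δ hδl (Eventually.of_forall fun n => ?_)
    rw [one_mul]; exact Metric.mem_closedBall_self (hδ0 n).le
  have hPn : ∀ᵐ x, P (-x) := (Measure.measurePreserving_neg (volume : Measure ℝ)).quasiMeasurePreserving.ae hPa
  have key : ∀ x y, P x → P y → x < y → 0 ≤ x + y → w y ≤ w x := by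
    intro x y hx hy hxy hs
    refine le_of_tendsto_of_tendsto hy hx ?_
    have : ∀ᶠ n in atTop, δ n < (y - x) / 2 := hδt.eventually_lt_const (by linarith)
    filter_upwards [this] with n hn
    have e1 : ∫ t in Metric.closedBall y (δ n), w t
        = ∫ t in Metric.closedBall x (δ n), w (2 * ((x + y) / 2) - t) := by
      rw [← integral_indicator Metric.isClosed_closedBall.measurableSet,
        ← integral_indicator Metric.isClosed_closedBall.measurableSet,
        ← mp_integral (sig_mp ((x + y) / 2))]
      · congr 1; funext t
        simp only [indicator, Metric.mem_closedBall, Real.dist_eq]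
        have : |2 * ((x + y) / 2) - t - y| = |t - x| := by
          rw [← abs_neg]; congr 1; ring
        rw [this]
      · exact (hw.meas.indicator Metric.isClosed_closedBall.measurableSet).aestronglyMeasurable
    rw [setAverage_eq, setAverage_eq, e1]
    have hv : volume.real (Metric.closedBall y (δ n)) = volume.real (Metric.closedBall x (δ n)) := by
      simp [Measure.real, Real.volume_closedBall]
    rw [hv]
    refine smul_le_smul_of_nonneg_left ?_ (by positivity)
    refine setIntegral_mono_ae_restrict ?_ ?_ ?_
    · have := (sig_mp ((x + y) / 2)).integrable_comp_of_integrable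
        ((hli.integrableOn_isCompact (isCompact_closedBall y (δ n))).integrable_indicator
          Metric.isClosed_closedBall.measurableSet)
      refine (this.integrableOn (s := Metric.closedBall x (δ n))).congr_fun (fun t ht => ?_)
        Metric.isClosed_closedBall.measurableSet
      simp only [indicator, Metric.mem_closedBall, Real.dist_eq, Function.comp] at ht ⊢
      have : |2 * ((x + y) / 2) - t - y| = |t - x| := by
          rw [← abs_neg]; congr 1; ring
      rw [this, if_pos ht]
    · exact hli.integrableOn_isCompact (isCompact_closedBall x (δ n))
    · rw [Filter.EventuallyLE, ae_restrict_iff' Metric.isClosed_closedBall.measurableSet]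
      filter_upwards [hm ((x + y) / 2) (by linarith)] with t ht htb
      apply ht
      rw [Metric.mem_closedBall, Real.dist_eq] at htb
      have := (abs_le.1 htb).2
      linarith
  refine ⟨{x | P x ∧ P (-x) ∧ 0 ≤ w x ∧ w (-x) = w x}, ?_, fun x hx => hx.2.2.1, ?_⟩
  · filter_upwards [hPa, hPn, h0, he] with x h1 h2 h3 h4 using ⟨h1, h2, h3, h4⟩
  · rintro x ⟨hx1, hx2, -, hx4⟩ y ⟨hy1, hy2, -, hy4⟩ hxy
    have ex : w |x| = w x := by
      rcases abs_choice x with h | h <;> rw [h]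
      exact hx4
    have ey : w |y| = w y := by
      rcases abs_choice y with h | h <;> rw [h]
      exact hy4
    have px : P |x| := by rcases abs_choice x with h | h <;> rw [h] <;> assumption
    have py : P |y| := by rcases abs_choice y with h | h <;> rw [h] <;> assumption
    rcases hxy.eq_or_lt with h | h
    · rw [← ex, ← ey, h]
    · rw [← ex, ← ey]; exact key _ _ px py h (by positivity)

def KP (u : ℝ → ℝ) : Prop :=
  memX' u ∧ (∀ x, 0 ≤ u x) ∧ ∀ x y, x ≠ 0 → |x| ≤ |y| → u y ≤ u x

def KK (u : ℝ → ℝ) : Prop :=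
  memX' u ∧ (∀ x, 0 ≤ u x) ∧ ∀ x y, |x| ≤ |y| → u y ≤ u x

lemma rad_meas {u : ℝ → ℝ} (h : ∀ x y, x ≠ 0 → |x| ≤ |y| → u y ≤ u x) : Measurable u := by
  have h1 : Measurable (fun x => if x ≤ 0 then 0 else u x) := by
    have : Measurable (fun x : Ioi (0:ℝ) => u x) := by
      have ha : Antitone (fun x : Ioi (0:ℝ) => u x) := fun a b hab => by
        have h1 : (0:ℝ) < a := a.2
        have h2 : (0:ℝ) < b := b.2
        exact h _ _ h1.ne' (by rw [abs_of_pos h1, abs_of_pos h2]; exact hab)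
      exact ha.measurable
    refine measurable_of_restrict_of_restrict_compl (measurableSet_Ioi (a := (0:ℝ))) ?_ ?_
    · convert this using 1; funext x; have : (0:ℝ) < x := x.2
      simp [this]
    · convert (measurable_const (a := (0:ℝ))) using 1; funext x
      have : ¬ (0:ℝ) < x := x.2
      simp [not_lt.1 this]
  have h2 : u = fun x => if x = 0 then u 0 else (fun x => if x ≤ 0 then 0 else u x) |x| := by
    funext x
    by_cases hx : x = 0
    · simp [hx]
    · have : ¬ |x| ≤ 0 := by simpa using hx
      simp only [hx, this, if_false]
      exact le_antisymm (h _ _ (by simpa using hx) (by simp)) (h _ _ hx (by simp))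
  rw [h2]
  exact Measurable.ite (measurableSet_singleton 0) measurable_const (h1.comp measurable_id.abs)

lemma rep_KP {w : ℝ → ℝ} (hw : memX' w) {E : Set ℝ} (hE : ∀ᵐ x, x ∈ E) (h0 : ∀ x ∈ E, 0 ≤ w x)
    (hm : ∀ x ∈ E, ∀ y ∈ E, |x| ≤ |y| → w y ≤ w x) : ∃ w1, KP w1 ∧ w =ᵐ[volume] w1 := by
  have hd : ∀ a b : ℝ, a < b → ∃ y ∈ E, a < y ∧ y < b := by
    intro a b hab
    have : Dense E := Measure.dense_of_ae hE
    obtain ⟨y, hy, hyE⟩ := this.inter_open_nonempty _ isOpen_Ioo (nonempty_Ioo.2 hab)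
    exact ⟨y, hyE, hy.1, hy.2⟩
  set S : ℝ → Set ℝ := fun x => {t | ∃ y ∈ E, |x| ≤ |y| ∧ w y = t} with hS
  set w1 : ℝ → ℝ := fun x => if x = 0 then 0 else sSup (S x) with hw1
  have hne : ∀ x, (S x).Nonempty := fun x => by
    obtain ⟨y, hy, h1, -⟩ := hd |x| (|x| + 1) (by linarith)
    exact ⟨w y, y, hy, h1.le.trans (le_abs_self y), rfl⟩
  have hbd : ∀ x, x ≠ 0 → BddAbove (S x) := fun x hx => by
    obtain ⟨y, hy, h1, h2⟩ := hd 0 |x| (by simpa using hx)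
    refine ⟨w y, ?_⟩
    rintro t ⟨z, hz, h3, rfl⟩
    refine hm y hy z hz ?_
    rw [abs_of_pos h1]; linarith
  have hS0 : ∀ x, ∀ t ∈ S x, 0 ≤ t := by
    rintro x t ⟨y, hy, -, rfl⟩; exact h0 y hy
  have hsup0 : ∀ x, 0 ≤ sSup (S x) := fun x => Real.sSup_nonneg (hS0 x)
  have hr : ∀ x y, x ≠ 0 → |x| ≤ |y| → w1 y ≤ w1 x := by
    intro x y hx hxy
    have hy : y ≠ 0 := by
      rintro rfl; apply hx; simpa using hxy
    simp only [hw1, hx, hy, if_false]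
    refine csSup_le_csSup (hbd x hx) (hne y) ?_
    rintro t ⟨z, hz, h1, h2⟩
    exact ⟨z, hz, hxy.trans h1, h2⟩
  have hwm : Measurable w1 := rad_meas hr
  have hww : w =ᵐ[volume] w1 := by
    have hz : ∀ᵐ x : ℝ, x ≠ 0 := by simp [ae_iff, measure_singleton]
    filter_upwards [hE, hz] with x hx hx0
    simp only [hw1, hx0, if_false]
    refine le_antisymm (le_csSup (hbd x hx0) ⟨x, hx, le_rfl, rfl⟩) (csSup_le (hne x) ?_)
    rintro t ⟨y, hy, h1, rfl⟩
    exact hm x hx y hy h1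
  refine ⟨w1, ⟨hw.congr hwm hww, fun x => ?_, hr⟩, hww⟩
  simp only [hw1]; split_ifs
  · rfl
  · exact hsup0 x


lemma gag_box {v : ℝ → ℝ} (hv : memX' v) {r d : ℝ} (hr : 0 < r)
    (h1 : ∀ x, 0 < x → x ≤ r / 4 → v x = d) (h2 : ∀ x, r ≤ x → v x = 0) :
    d ^ 2 / 16 ≤ gagSq v := by
  set B : Set (ℝ × ℝ) := Ioo 0 (r / 4) ×ˢ Ioo r (2 * r) with hB
  have hBm : MeasurableSet B := measurableSet_Ioo.prod measurableSet_Ioo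
  have hvol : volume.real B = r / 4 * r := by
    have hB2 : volume B = ENNReal.ofReal (r / 4) * ENNReal.ofReal r := by
      rw [hB, Measure.volume_eq_prod, Measure.prod_prod, Real.volume_Ioo, Real.volume_Ioo]
      congr 2 <;> ring
    rw [Measure.real, hB2, ENNReal.toReal_mul, ENNReal.toReal_ofReal (by positivity),
      ENNReal.toReal_ofReal hr.le]
  have hBf : volume B ≠ ⊤ := by
    rw [hB, Measure.volume_eq_prod, Measure.prod_prod, Real.volume_Ioo, Real.volume_Ioo]
    exact ENNReal.mul_ne_top (by simp) (by simp)
  have e : d ^ 2 / 16 = ∫ p in B, d ^ 2 / (2 * r) ^ 2 := by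
    rw [setIntegral_const, hvol, smul_eq_mul]; field_simp; ring
  rw [e]
  refine le_trans (setIntegral_mono_on (g := gagKer v) ?_ hv.gi.integrableOn hBm ?_)
    (setIntegral_le_integral hv.gi (ae_of_all _ (gagKer_nonneg v)))
  · exact integrableOn_const hBf
  · rintro ⟨x, y⟩ ⟨⟨hx1, hx2⟩, hy1, hy2⟩
    simp only at hx1 hx2 hy1 hy2
    simp only [gagKer]
    rw [h1 x hx1 hx2.le, h2 y hy1.le, sub_zero]
    have h3 : 0 < |x - y| := abs_pos.2 (by linarith)
    have h4 : |x - y| ≤ 2 * r := by rw [abs_le]; constructor <;> linarith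
    gcongr

lemma KP_bdd {w h : ℝ → ℝ} (hw : KP w) (hh : MemLp h 2 volume)
    (hle : ∀ v, memX' v → (∀ x, 0 ≤ v x) → innerX w v / (2 * π) ≤ ∫ x, h x * v x) :
    ∃ B, ∀ x, x ≠ 0 → w x ≤ B := by
  obtain ⟨hX, hw0, hr⟩ := hw
  set H := ∫ x, h x ^ 2 with hH
  have hH0 : 0 ≤ H := integral_nonneg fun x => by positivity
  set r : ℕ → ℝ := fun j => (1 / 4) ^ j with hrd
  have hr0 : ∀ j, 0 < r j := fun j => by positivity
  have hrs : ∀ j, r (j + 1) = r j / 4 := fun j => by simp only [hrd, pow_succ]; ring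
  set m : ℕ → ℝ := fun j => w (r j) with hm
  have hstep : ∀ j, m (j + 1) - m j ≤ (1 / 2) ^ j * (32 * π * (H / 2 + 1)) := by
    intro j
    set δ := m (j + 1) - m j with hδ
    have hδ0 : 0 ≤ δ := by
      have := hr (r (j + 1)) (r j) (hr0 _).ne' (by
        rw [abs_of_pos (hr0 _), abs_of_pos (hr0 _), hrs]; linarith [hr0 j])
      simp only [hδ, hm]; linarith
    have hm0 : 0 ≤ m j := hw0 _
    set v : ℝ → ℝ := fun x => min (max (w x - m j) 0) δ with hv
    have hvle : ∀ x, v x ≤ δ := fun x => min_le_right _ _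
    have hv0 : ∀ x, 0 ≤ v x := fun x => le_min (le_max_right _ _) hδ0
    have hvm : Measurable v := ((hX.meas.sub_const _).max measurable_const).min measurable_const
    have hcl : ∀ x y, |v x - v y| ≤ |w x - w y| := fun x y => by
      simp only [hv]
      refine (abs_min_sub_min_le_max _ _ _ _).trans ?_
      rw [sub_self, abs_zero, max_eq_left (abs_nonneg _)]
      refine (abs_max_sub_max_le_max _ _ _ _).trans ?_
      rw [sub_self, abs_zero, max_eq_left (abs_nonneg _)]
      apply le_of_eq; congr 1; ring
    have hmono : ∀ x y, w x ≤ w y → v x ≤ v y := fun x y hxy => by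
      simp only [hv]; gcongr
    have hvX : memX' v := by
      refine hX.dom hvm hcl fun x => ?_
      rw [abs_of_nonneg (hv0 x), abs_of_nonneg (hw0 x)]
      refine (min_le_left _ _).trans (max_le ?_ (hw0 x)); linarith
    have h1 : ∀ x, x ≠ 0 → |x| ≤ r j / 4 → v x = δ := fun x hx0 hx => by
      have := hr x (r (j + 1)) hx0 (by rw [abs_of_pos (hr0 _), hrs]; exact hx)
      simp only [hv]
      apply min_eq_right; apply le_max_of_le_left
      simp only [hδ, hm]; linarith
    have h2 : ∀ x, r j ≤ |x| → v x = 0 := fun x hx => by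
      have := hr (r j) x (hr0 _).ne' (by rw [abs_of_pos (hr0 _)]; exact hx)
      simp only [hv]
      rw [max_eq_right (by simp only [hm]; linarith)]
      exact min_eq_left hδ0
    have b1 := gag_box hvX (hr0 j) (d := δ)
      (fun x hx hx2 => h1 x hx.ne' (by rwa [abs_of_pos hx]))
      (fun x hx => h2 x (hx.trans (le_abs_self x)))
    have b2 : gagSq v ≤ innerX w v := by
      rw [gagSq_eq]
      refine integral_mono (hvX.ii hvX) (hX.ii hvX) fun p => ?_
      simp only [innerKer]
      apply div_le_div_of_nonneg_right _ (by positivity)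
      have a1 := hcl p.1 p.2
      rcases le_total (w p.1) (w p.2) with hc | hc
      · have := hmono _ _ hc
        rw [abs_of_nonpos (by linarith), abs_of_nonpos (by linarith)] at a1
        nlinarith
      · have := hmono _ _ hc
        rw [abs_of_nonneg (by linarith), abs_of_nonneg (by linarith)] at a1
        nlinarith
    have b3 := hle v hvX hv0
    set s : ℝ := (1 / 2) ^ j with hs
    have hs0 : 0 < s := by positivity
    have hrs2 : r j = s ^ 2 := by
      simp only [hrd, hs]; rw [← pow_mul, mul_comm, pow_mul]; norm_num
    have b4 : ∫ x, h x * v x ≤ δ * (s * (H / 2 + 1)) := by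
      have i2 : Integrable (indicator (Icc (-r j) (r j)) (fun _ : ℝ => 1 / (2 * s))) := by
        apply IntegrableOn.integrable_indicator _ measurableSet_Icc
        exact integrableOn_const (by simp)
      have i1 : Integrable (fun x => δ * (s / 2 * h x ^ 2 + indicator (Icc (-r j) (r j)) (fun _ : ℝ => 1 / (2 * s)) x)) :=
        ((hh.integrable_sq.const_mul _).add i2).const_mul _
      refine (integral_mono (hh.integrable_mul hvX.memLp) i1 fun x => ?_).trans (le_of_eq ?_)
      · simp only [Pi.mul_apply]
        by_cases hx : x ∈ Icc (-r j) (r j)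
        · rw [indicator_of_mem hx]
          have : h x ≤ s / 2 * h x ^ 2 + 1 / (2 * s) := by
            have : s / 2 * h x ^ 2 + 1 / (2 * s) - h x = (s * h x - 1) ^ 2 / (2 * s) := by
              field_simp; ring
            have h5 : 0 ≤ (s * h x - 1) ^ 2 / (2 * s) := by positivity
            linarith
          have h6 : 0 ≤ s / 2 * h x ^ 2 + 1 / (2 * s) := by positivity
          calc h x * v x ≤ (s / 2 * h x ^ 2 + 1 / (2 * s)) * v x :=
                mul_le_mul_of_nonneg_right this (hv0 x)
            _ ≤ (s / 2 * h x ^ 2 + 1 / (2 * s)) * δ := mul_le_mul_of_nonneg_left (hvle x) h6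
            _ = _ := mul_comm _ _
        · rw [h2 x, mul_zero, indicator_of_notMem hx, add_zero]
          · positivity
          · by_contra! hc
            exact hx ⟨(abs_lt.1 hc).1.le, (abs_lt.1 hc).2.le⟩
      · rw [integral_const_mul, integral_add (hh.integrable_sq.const_mul _) i2, integral_const_mul,
          integral_indicator measurableSet_Icc, setIntegral_const]
        have : volume.real (Icc (-r j) (r j)) = 2 * r j := by
          rw [Measure.real, Real.volume_Icc, ENNReal.toReal_ofReal (by linarith [hr0 j])]; ring
        rw [this, hrs2, smul_eq_mul, ← hH]; field_simp
    have hπ := Real.pi_pos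
    have b5 : innerX w v ≤ 2 * π * (δ * (s * (H / 2 + 1))) := by
      have := b3.trans b4
      rw [div_le_iff₀ (by positivity)] at this
      linarith
    rcases hδ0.eq_or_lt with h0 | h0
    · rw [← h0]; positivity
    · have : δ * δ ≤ δ * (s * (32 * π * (H / 2 + 1))) := by
        nlinarith
      exact le_of_mul_le_mul_left this h0
  set C := 32 * π * (H / 2 + 1) with hC
  have hC0 : 0 ≤ C := by have := Real.pi_pos; positivity
  have hmj : ∀ j, m j ≤ m 0 + 2 * C - 2 * C * (1 / 2) ^ j := by
    intro j
    induction j with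
    | zero => simp
    | succ j ih => have := hstep j; rw [pow_succ]; linarith
  refine ⟨m 0 + 2 * C, fun x hx => ?_⟩
  obtain ⟨j, hj⟩ := exists_pow_lt_of_lt_one (abs_pos.2 hx) (by norm_num : (1 / 4 : ℝ) < 1)
  have := hr (r j) x (hr0 j).ne' (by rw [abs_of_pos (hr0 j)]; exact hj.le)
  have h2 := hmj j
  have : 0 ≤ 2 * C * (1 / 2) ^ j := by positivity
  have h3 : w x ≤ m j := by assumption
  linarith

lemma KP_to_KK {w h : ℝ → ℝ} (hw : KP w) (hh : MemLp h 2 volume)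
    (hle : ∀ v, memX' v → (∀ x, 0 ≤ v x) → innerX w v / (2 * π) ≤ ∫ x, h x * v x) :
    ∃ w2, KK w2 ∧ w =ᵐ[volume] w2 := by
  obtain ⟨B, hB⟩ := KP_bdd hw hh hle
  have hz : ∀ᵐ x : ℝ, x ≠ 0 := by simp [ae_iff, measure_singleton]
  have hww : w =ᵐ[volume] fun x => if x = 0 then B else w x := by
    filter_upwards [hz] with x hx
    simp [hx]
  have hB0 : 0 ≤ B := (hw.2.1 1).trans (hB 1 one_ne_zero)
  refine ⟨_, ⟨hw.1.congr (Measurable.ite (measurableSet_singleton 0) measurable_const hw.1.meas) hww,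
    fun x => ?_, fun x y hxy => ?_⟩, hww⟩
  · show 0 ≤ if x = 0 then B else w x
    split_ifs
    · exact hB0
    · exact hw.2.1 x
  · show (if y = 0 then B else w y) ≤ if x = 0 then B else w x
    split_ifs with h1 h2 h2
    · rfl
    · subst h1; exfalso; apply h2; simpa using hxy
    · exact hB y h1
    · exact hw.2.2 x y h2 hxy

lemma res_K {L : ℝ} (hL : 0 < L) {h : ℝ → ℝ} (hh : MemLp h 2 volume) (h0 : ∀ x, 0 ≤ h x)
    (hd : ∀ x y, |x| ≤ |y| → h y ≤ h x) :
    ∃ w, KK w ∧ ∀ v, memX' v → innerX w v / (2 * π) + L * ∫ x, w x * v x = ∫ x, h x * v x := by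
  obtain ⟨w, hw, heq⟩ := resolvent_exists hh hL
  have hw0 := res_nonneg hL h0 hw heq
  obtain ⟨E, hE, hE0, hEm⟩ := mono_pts hw hw0 (res_even hL hh hd hw heq)
    (fun a ha => res_mono hL hh hd hw hw0 heq ha)
  obtain ⟨w1, hw1, e1⟩ := rep_KP hw hE hE0 hEm
  have tr : ∀ {w1 : ℝ → ℝ}, w =ᵐ[volume] w1 → ∀ v, memX' v →
      innerX w1 v / (2 * π) + L * ∫ x, w1 x * v x = ∫ x, h x * v x := by
    intro w1 e1 v hv
    rw [← heq v hv, ← innerX_congr e1 (ae_eq_refl v)]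
    congr 2
    exact integral_congr_ae (by filter_upwards [e1] with x hx; rw [hx])
  obtain ⟨w2, hw2, e2⟩ := KP_to_KK hw1 hh (fun v hv hv0 => by
    have := tr e1 v hv
    have h3 : 0 ≤ ∫ x, w1 x * v x := integral_nonneg fun x => mul_nonneg (hw1.2.1 x) (hv0 x)
    have := mul_nonneg hL.le h3
    linarith)
  exact ⟨w2, hw2, tr (e1.trans e2)⟩


def mu : Measure ℝ := volume.restrict (Ioo (-1 : ℝ) 1)

instance mu_fin : IsFiniteMeasure mu := ⟨by simp [mu]⟩

lemma mu_le : mu ≤ volume := Measure.restrict_le_self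

lemma ae_mu {P : ℝ → Prop} (h : ∀ᵐ x : ℝ, P x) : ∀ᵐ x ∂mu, P x := ae_restrict_of_ae h

lemma memX'.mLp {u : ℝ → ℝ} (hu : memX' u) : MemLp u 2 mu := hu.memLp.restrict _

lemma memX'.msq {u : ℝ → ℝ} (hu : memX' u) : Integrable (fun x => u x ^ 2) mu := hu.mLp.integrable_sq

lemma memX'.mmul {u v : ℝ → ℝ} (hu : memX' u) (hv : memX' v) : Integrable (fun x => u x * v x) mu :=
  hu.mLp.integrable_mul hv.mLp

lemma mu_poinc {u : ℝ → ℝ} (hu : memX' u) : lam1' * ∫ x, u x ^ 2 ∂mu ≤ gagSq u := poinc hu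

def SubC (Q : ℝ → ℝ) : Prop :=
  ∀ α : ℝ, 0 < α → ∃ C : ℝ, 0 ≤ C ∧ ∀ t : ℝ, 0 ≤ t → |Q t| ≤ C * exp (α * t ^ 2)

lemma SubC.mono {P Q : ℝ → ℝ} (h : SubC Q) (hp : ∀ t, 0 ≤ t → |P t| ≤ |Q t|) : SubC P := by
  intro α hα
  obtain ⟨C, h0, hC⟩ := h α hα
  exact ⟨C, h0, fun t ht => (hp t ht).trans (hC t ht)⟩

lemma SubC.add {P Q : ℝ → ℝ} (hP : SubC P) (hQ : SubC Q) : SubC (fun t => P t + Q t) := by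
  intro α hα
  obtain ⟨C, h0, hC⟩ := hP α hα
  obtain ⟨D, h0', hD⟩ := hQ α hα
  refine ⟨C + D, by positivity, fun t ht => (abs_add_le _ _).trans ?_⟩
  rw [add_mul]; exact add_le_add (hC t ht) (hD t ht)

lemma SubC.mul {P Q : ℝ → ℝ} (hP : SubC P) (hQ : SubC Q) : SubC (fun t => P t * Q t) := by
  intro α hα
  obtain ⟨C, h0, hC⟩ := hP (α / 2) (by positivity)
  obtain ⟨D, h0', hD⟩ := hQ (α / 2) (by positivity)
  refine ⟨C * D, by positivity, fun t ht => ?_⟩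
  rw [abs_mul]
  refine (mul_le_mul (hC t ht) (hD t ht) (abs_nonneg _) (by positivity)).trans (le_of_eq ?_)
  have : exp (α * t ^ 2) = exp (α / 2 * t ^ 2) * exp (α / 2 * t ^ 2) := by
    rw [← exp_add]; congr 1; ring
  rw [this]; ring

lemma SubC_const (c : ℝ) : SubC (fun _ => c) := by
  intro α hα
  refine ⟨|c|, abs_nonneg c, fun t _ => ?_⟩
  have : 1 ≤ exp (α * t ^ 2) := one_le_exp (by positivity)
  nlinarith [abs_nonneg c]

lemma SubC_id : SubC (fun t => t) := by
  intro α hα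
  refine ⟨1 + 1 / α, by positivity, fun t ht => ?_⟩
  have h1 := add_one_le_exp (α * t ^ 2)
  have h2 : t ≤ 1 + t ^ 2 := by nlinarith [sq_nonneg (t - 1)]
  rw [abs_of_nonneg ht]
  have h3 : t ^ 2 ≤ 1 / α * exp (α * t ^ 2) := by
    rw [one_div, inv_mul_eq_div, le_div_iff₀ hα]; linarith
  have h4 : 1 ≤ exp (α * t ^ 2) := one_le_exp (by positivity)
  nlinarith

lemma TMb {ω : ℝ} (hω : 0 < ω) (hTM : TMprop' ω) {Q : ℝ → ℝ} (hQ : SubC Q) (R : ℝ) (hR : 0 ≤ R) :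
    ∃ C : ℝ, 0 ≤ C ∧ ∀ u, memX' u → (∀ x, 0 ≤ u x) → gagSq u ≤ R → ∀ h : ℝ → ℝ, Measurable h →
      (∀ x, |h x| ≤ Q (u x)) → Integrable h mu ∧ ∫ x, |h x| ∂mu ≤ C := by
  have hπ := Real.pi_pos
  obtain ⟨K, hK, hKb⟩ := hTM (π * ω) (by positivity) (by nlinarith [mul_pos hπ hω])
  obtain ⟨C, hC0, hC⟩ := hQ (π * ω / (R + 1)) (by positivity)
  refine ⟨C * K, by positivity, fun u hu hu0 hg h hm hh => ?_⟩
  have hs : 0 < √(R + 1) := Real.sqrt_pos.2 (by linarith)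
  have b := hKb (fun x => (√(R + 1))⁻¹ * u x) (hu.smul _) (by
    rw [gagNorm, Real.sqrt_le_iff]
    refine ⟨zero_le_one, ?_⟩
    rw [one_pow, gagSq_smul, inv_pow, Real.sq_sqrt (by linarith),
      inv_mul_le_iff₀ (by linarith)]
    linarith)
  have e : ∀ x, π * ω * ((√(R + 1))⁻¹ * u x) ^ 2 = π * ω / (R + 1) * u x ^ 2 := fun x => by
    rw [mul_pow, inv_pow, Real.sq_sqrt (by linarith)]; ring
  simp only [e] at b
  have hb2 : ∀ x, |h x| ≤ C * exp (π * ω / (R + 1) * u x ^ 2) := fun x =>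
    ((hh x).trans (le_abs_self _)).trans (hC _ (hu0 x))
  have l : ∫⁻ x, ENNReal.ofReal |h x| ∂mu ≤ ENNReal.ofReal (C * K) := by
    calc ∫⁻ x, ENNReal.ofReal |h x| ∂mu
        ≤ ∫⁻ x, ENNReal.ofReal C * ENNReal.ofReal (exp (π * ω / (R + 1) * u x ^ 2)) ∂mu := by
          refine lintegral_mono fun x => ?_
          rw [← ENNReal.ofReal_mul hC0]
          exact ENNReal.ofReal_le_ofReal (hb2 x)
      _ = ENNReal.ofReal C * ∫⁻ x, ENNReal.ofReal (exp (π * ω / (R + 1) * u x ^ 2)) ∂mu :=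
          lintegral_const_mul' _ _ ENNReal.ofReal_ne_top
      _ ≤ ENNReal.ofReal C * ENNReal.ofReal K := by gcongr; exact b
      _ = _ := (ENNReal.ofReal_mul hC0).symm
  have hi : Integrable h mu := by
    refine ⟨hm.aestronglyMeasurable, ?_⟩
    rw [hasFiniteIntegral_iff_norm]
    exact l.trans_lt ENNReal.ofReal_lt_top
  refine ⟨hi, ?_⟩
  rw [← ofReal_integral_eq_lintegral_ofReal hi.abs (ae_of_all _ fun x => abs_nonneg _)] at l
  exact (ENNReal.ofReal_le_ofReal_iff (by positivity)).1 l

lemma LIM {ω : ℝ} (hω : 0 < ω) (hTM : TMprop' ω) {Q : ℝ → ℝ} (hQ : SubC Q) (R : ℝ) (hR : 0 ≤ R)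
    {u h : ℕ → ℝ → ℝ} (hu : ∀ n, memX' (u n)) (hu0 : ∀ n x, 0 ≤ u n x) (hg : ∀ n, gagSq (u n) ≤ R)
    (hm : ∀ n, Measurable (h n)) (hh : ∀ n x, |h n x| ≤ Q (u n x)) {g φ : ℝ → ℝ} (hgm : Measurable g)
    (hlim : ∀ᵐ x ∂mu, Tendsto (fun n => h n x) atTop (𝓝 (g x)))
    (hφm : Measurable φ) (hφ : Integrable (fun x => φ x ^ 2) mu) :
    Tendsto (fun n => ∫ x, h n x * φ x ∂mu) atTop (𝓝 (∫ x, g x * φ x ∂mu)) := by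
  obtain ⟨C, hC, hb⟩ := TMb hω hTM (hQ.mul hQ) R hR
  have hb' := fun n => hb (u n) (hu n) (hu0 n) (hg n) (fun x => h n x ^ 2) ((hm n).pow_const 2)
    (fun x => by
      rw [abs_of_nonneg (sq_nonneg _), ← sq_abs, sq]
      exact mul_self_le_mul_self (abs_nonneg _) (hh n x))
  refine weak_lim hC hm hgm hφm (fun n => (hb' n).1) (fun n => ?_) hlim hφ
  refine le_trans (le_of_eq ?_) (hb' n).2
  congr 1; funext x; rw [abs_of_nonneg (sq_nonneg _)]

lemma KK.zero_off {u : ℝ → ℝ} (hu : KK u) : ∀ x, 1 < |x| → u x = 0 := by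
  intro x hx
  have hd : Dense {x | x ∉ Ioo (-1 : ℝ) 1 → u x = 0} := Measure.dense_of_ae hu.1.off
  obtain ⟨y, hy, hy2⟩ := hd.inter_open_nonempty _ isOpen_Ioo (nonempty_Ioo.2 hx)
  have h1 : u y = 0 := hy2 (fun h => by linarith [h.2, hy.1])
  have h2 := hu.2.2 y x (by rw [abs_of_pos (by linarith [hy.1])]; exact hy.2.le)
  exact le_antisymm (h1 ▸ h2) (hu.2.1 x)

lemma KK.le0 {u : ℝ → ℝ} (hu : KK u) (x : ℝ) : u x ≤ u 0 := hu.2.2 0 x (by simp)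

lemma KK.bdq {u : ℝ → ℝ} (hu : KK u) {q : ℝ → ℝ} (hq : Continuous q) : ∃ C, 0 ≤ C ∧ ∀ x, |q (u x)| ≤ C := by
  obtain ⟨C, hC⟩ := isCompact_Icc.exists_bound_of_continuousOn (s := Icc 0 (u 0)) hq.continuousOn
  exact ⟨C, (abs_nonneg _).trans (hC (u 0) ⟨hu.2.1 0, le_rfl⟩), fun x => hC _ ⟨hu.2.1 x, hu.le0 x⟩⟩

lemma KK.mq {u : ℝ → ℝ} (hu : KK u) {q : ℝ → ℝ} (hq : Continuous q) : MemLp (fun x => q (u x)) 2 mu := by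
  obtain ⟨C, -, hC⟩ := hu.bdq hq
  exact MemLp.of_bound (hq.measurable.comp hu.1.meas).aestronglyMeasurable C (ae_of_all _ hC)

lemma KK.iq {u : ℝ → ℝ} (hu : KK u) {q : ℝ → ℝ} (hq : Continuous q) : Integrable (fun x => q (u x)) mu :=
  (hu.mq hq).integrable (by norm_num)

lemma KK.iqv {u : ℝ → ℝ} (hu : KK u) {q : ℝ → ℝ} (hq : Continuous q) {v : ℝ → ℝ} (hv : memX' v) :
    Integrable (fun x => q (u x) * v x) mu := (hu.mq hq).integrable_mul hv.mLp

lemma KK.comb {u v : ℝ → ℝ} (hu : KK u) (hv : KK v) {a b : ℝ} (ha : 0 ≤ a) (hb : 0 ≤ b) :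
    KK (fun x => a * u x + b * v x) := by
  refine ⟨(hu.1.smul a).add (hv.1.smul b), fun x => ?_, fun x y h => ?_⟩
  · have := hu.2.1 x; have := hv.2.1 x; positivity
  · have h1 := hu.2.2 x y h
    have h2 := hv.2.2 x y h
    show a * u y + b * v y ≤ a * u x + b * v x
    gcongr

lemma gag_le2 {u v : ℝ → ℝ} (hu : memX' u) (hv : memX' v) :
    gagSq u ≤ 2 * gagSq (fun x => u x - v x) + 2 * gagSq v := by
  have h := gagSq_nonneg (fun x => (u x - v x) - v x)
  have d := hu.sub hv
  have e0 : gagSq (fun x => (u x - v x) - v x) = gagSq (fun x => u x - v x)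
      - 2 * innerX (fun x => u x - v x) v + gagSq v := by
    rw [gagSq_eq, innerX_sub_left d hv (d.sub hv), innerX_sub_right d hv d, innerX_sub_right d hv hv,
      innerX_comm v, gagSq_eq, gagSq_eq]; ring
  have e1 : gagSq u = gagSq (fun x => u x - v x) + 2 * innerX (fun x => u x - v x) v + gagSq v := by
    have : u = fun x => (u x - v x) + v x := by funext x; ring
    conv_lhs => rw [this, gagSq_eq, innerX_add_left d hv (d.add hv), innerX_add_right d hv d,
      innerX_add_right d hv hv, innerX_comm v]
    rw [gagSq_eq, gagSq_eq]; ring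
  linarith

lemma CONT {ω : ℝ} (hω : 0 < ω) (hTM : TMprop' ω) (hl : 0 < lam1') {q : ℝ → ℝ} (hq : Continuous q)
    (hs : SubC q) {u : ℕ → ℝ → ℝ} {v : ℝ → ℝ} (hu : ∀ n, KK (u n)) (hv : KK v)
    (hlim : Tendsto (fun n => gagSq (fun x => u n x - v x)) atTop (𝓝 0)) :
    Tendsto (fun n => ∫ x, (q (u n x) - q (v x)) ^ 2 ∂mu) atTop (𝓝 0) := by
  refine tendsto_of_subseq_tendsto fun ns hns => ?_
  have hl1 := hlim.comp hns
  have hL2 : Tendsto (fun n => ∫ x, (u (ns n) x - v x) ^ 2 ∂mu) atTop (𝓝 0) := by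
    have : Tendsto (fun n => gagSq (fun x => u (ns n) x - v x) / lam1') atTop (𝓝 (0 / lam1')) := hl1.div_const _
    rw [zero_div] at this
    refine squeeze_zero (fun n => integral_nonneg fun x => by positivity) (fun n => ?_) this
    rw [le_div_iff₀ hl, mul_comm]
    exact mu_poinc ((hu _).1.sub hv.1)
  have hme : TendstoInMeasure mu (fun n x => (u (ns n) x - v x) ^ 2) atTop (fun _ => 0) := by
    refine tendstoInMeasure_of_tendsto_eLpNorm (p := 1) one_ne_zero
      (fun n => (((hu _).1.meas.sub hv.1.meas).pow_const 2).aestronglyMeasurable)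
      aestronglyMeasurable_const ?_
    have := ENNReal.tendsto_ofReal hL2
    rw [ENNReal.ofReal_zero] at this
    refine this.congr fun n => ?_
    rw [ofReal_integral_eq_lintegral_ofReal ((hu _).1.sub hv.1).msq (ae_of_all _ fun x => by positivity),
      eLpNorm_one_eq_lintegral_enorm]
    refine lintegral_congr fun x => ?_
    simp only [Pi.sub_apply, sub_zero]
    rw [Real.enorm_eq_ofReal (by positivity)]
  obtain ⟨ms, hms, hae⟩ := hme.exists_seq_tendsto_ae
  obtain ⟨D, hD⟩ := hlim.bddAbove_range
  have hg : ∀ n, gagSq (u (ns (ms n))) ≤ 2 * max D 0 + 2 * gagSq v := fun n => by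
    have := gag_le2 (hu (ns (ms n))).1 hv.1
    have h2 := hD ⟨ns (ms n), rfl⟩
    have h3 := le_max_left D 0
    simp only at h2
    linarith
  obtain ⟨C, hC0, hC⟩ := hv.bdq hq
  have hsub : SubC (fun t => 2 * (q t * q t) + 2 * C ^ 2) :=
    ((SubC_const 2).mul (hs.mul hs)).add (SubC_const _)
  refine ⟨ms, ?_⟩
  have hqm : ∀ {w : ℝ → ℝ}, KK w → Measurable (fun x => q (w x)) := fun hw => hq.measurable.comp hw.1.meas
  have := LIM hω hTM hsub (2 * max D 0 + 2 * gagSq v)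
    (by have := gagSq_nonneg v; positivity) (u := fun n => u (ns (ms n)))
    (h := fun n x => (q (u (ns (ms n)) x) - q (v x)) ^ 2) (g := fun _ => 0) (φ := fun _ => 1)
    (fun n => (hu _).1) (fun n => (hu _).2.1) hg
    (fun n => ((hqm (hu _)).sub (hqm hv)).pow_const 2)
    (fun n x => by
      rw [abs_of_nonneg (sq_nonneg _)]
      have h1 := hC x
      have h2 : q (v x) ^ 2 ≤ C ^ 2 := by rw [← sq_abs]; gcongr
      nlinarith [sq_nonneg (q (u (ns (ms n)) x) + q (v x))])
    measurable_const (by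
      filter_upwards [hae] with x hx
      have h1 : Tendsto (fun n => u (ns (ms n)) x) atTop (𝓝 (v x)) := by
        have := (Real.continuous_sqrt.tendsto 0).comp hx
        rw [Real.sqrt_zero] at this
        have h2 : Tendsto (fun n => |u (ns (ms n)) x - v x|) atTop (𝓝 0) :=
          this.congr fun n => by simp [Real.sqrt_sq_eq_abs]
        have h3 := (tendsto_zero_iff_abs_tendsto_zero _).2 h2
        have := h3.add_const (v x)
        simpa using this
      have h4 := (((hq.tendsto (v x)).comp h1).sub_const (q (v x))).pow 2
      simpa using h4) measurable_const (by simp)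
  simpa using this


lemma int3 {a b c : ℝ → ℝ} (ha : Integrable a mu) (hb : Integrable b mu) (hc : Integrable c mu) :
    ∫ x, a x ∂mu + ∫ x, b x ∂mu + ∫ x, c x ∂mu = ∫ x, (a x + b x + c x) ∂mu := by
  have hab : Integrable (fun x => a x + b x) mu := ha.add hb
  rw [← integral_add ha hb, ← integral_add hab hc]

lemma gag_exp {u v : ℝ → ℝ} (hu : memX' u) (hv : memX' v) (s : ℝ) :
    gagSq (fun x => u x + s * v x) = gagSq u + 2 * s * innerX u v + s ^ 2 * gagSq v := by
  rw [gagSq_eq, innerX_add_left hu (hv.smul s) (hu.add (hv.smul s)),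
    innerX_add_right hu (hv.smul s) hu, innerX_add_right hu (hv.smul s) (hv.smul s),
    innerX_smul_left, innerX_smul_right, innerX_smul_left, innerX_smul_right, innerX_comm v u,
    gagSq_eq, gagSq_eq]
  ring

lemma sq_exp {u v : ℝ → ℝ} (hu : memX' u) (hv : memX' v) (s : ℝ) :
    ∫ x, (u x + s * v x) * (u x + s * v x) ∂mu
      = ∫ x, u x * u x ∂mu + 2 * s * ∫ x, u x * v x ∂mu + s ^ 2 * ∫ x, v x * v x ∂mu := by
  rw [← integral_const_mul, ← integral_const_mul,
    int3 (hu.mmul hu) ((hu.mmul hv).const_mul _) ((hv.mmul hv).const_mul _)]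
  congr 1; funext x; ring

def BL (L : ℝ) (u v : ℝ → ℝ) : ℝ := innerX u v / (2 * π) + L * ∫ x, u x * v x ∂mu

lemma BL_exp (L : ℝ) {u v : ℝ → ℝ} (hu : memX' u) (hv : memX' v) (s : ℝ) :
    BL L (fun x => u x + s * v x) (fun x => u x + s * v x)
      = BL L u u + 2 * s * BL L u v + s ^ 2 * BL L v v := by
  unfold BL
  rw [sq_exp hu hv, ← gagSq_eq, gag_exp hu hv, gagSq_eq, gagSq_eq]
  ring

lemma BL_nonneg {L : ℝ} (hL : 0 ≤ L) (u : ℝ → ℝ) : 0 ≤ BL L u u := by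
  unfold BL
  rw [← gagSq_eq]
  have h1 := gagSq_nonneg u
  have h2 : 0 ≤ ∫ x, u x * u x ∂mu := integral_nonneg fun x => mul_self_nonneg _
  have := Real.pi_pos
  positivity

lemma BL_sub_left (L : ℝ) {u v w : ℝ → ℝ} (hu : memX' u) (hv : memX' v) (hw : memX' w) :
    BL L (fun x => u x - v x) w = BL L u w - BL L v w := by
  unfold BL
  rw [innerX_sub_left hu hv hw]
  have : ∫ x, (u x - v x) * w x ∂mu = ∫ x, u x * w x ∂mu - ∫ x, v x * w x ∂mu := by
    rw [← integral_sub (hu.mmul hw) (hv.mmul hw)]; congr 1; funext x; ring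
  rw [this]; ring

lemma inner_cs {u v : ℝ → ℝ} (hu : memX' u) (hv : memX' v) : innerX u v ^ 2 ≤ gagSq u * gagSq v := by
  have := discrim_le_zero (a := gagSq v) (b := 2 * innerX u v) (c := gagSq u) (fun s => by
    have := gagSq_nonneg (fun x => u x + s * v x)
    rw [gag_exp hu hv] at this
    linarith)
  rw [discrim] at this
  linarith

lemma gag_cont {u : ℕ → ℝ → ℝ} {v : ℝ → ℝ} (hu : ∀ n, memX' (u n)) (hv : memX' v)
    (hlim : Tendsto (fun n => gagSq (fun x => u n x - v x)) atTop (𝓝 0)) :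
    Tendsto (fun n => gagSq (u n)) atTop (𝓝 (gagSq v)) := by
  have h1 : Tendsto (fun n => innerX (fun x => u n x - v x) v) atTop (𝓝 0) := by
    have h2 : Tendsto (fun n => √(gagSq (fun x => u n x - v x) * gagSq v)) atTop (𝓝 0) := by
      have := (Real.continuous_sqrt.tendsto _).comp (hlim.mul_const (gagSq v))
      rw [zero_mul, Real.sqrt_zero] at this
      exact this
    refine squeeze_zero_norm (fun n => ?_) h2
    rw [norm_eq_abs]
    exact Real.abs_le_sqrt (inner_cs ((hu n).sub hv) hv)
  have e : ∀ n, gagSq (u n) = gagSq (fun x => u n x - v x) + 2 * 1 * innerX (fun x => u n x - v x) v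
      + 1 ^ 2 * gagSq v := fun n => by
    rw [← gag_exp ((hu n).sub hv) hv]; congr 1; funext x; ring
  simp only [e]
  have := (hlim.add (h1.const_mul (2 * 1))).add_const (1 ^ 2 * gagSq v)
  simpa using this

structure NL (k : ℝ → ℝ) (L : ℝ) : Prop where
  cont : Continuous k
  nn : ∀ t, 0 ≤ t → 0 ≤ k t
  mono : ∀ s t, 0 ≤ s → s ≤ t → k s + L * s ≤ k t + L * t
  sub : SubC k
  Lp : 0 < L

def JJ (k : ℝ → ℝ) (u : ℝ → ℝ) : ℝ := gagSq u / (4 * π) - ∫ x, primF k (u x) ∂mu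

lemma primF_cont {k : ℝ → ℝ} (hk : Continuous k) : Continuous (primF k) :=
  intervalIntegral.continuous_primitive (fun a b => hk.intervalIntegrable a b) 0

lemma primF_sub {k : ℝ → ℝ} (hk : Continuous k) (a b : ℝ) : primF k b - primF k a = ∫ x in a..b, k x :=
  intervalIntegral.integral_interval_sub_left (hk.intervalIntegrable 0 b) (hk.intervalIntegrable 0 a)

lemma NL.conv {k : ℝ → ℝ} {L : ℝ} (hk : NL k L) {a b : ℝ} (ha : 0 ≤ a) (hb : 0 ≤ b) :
    primF k a + L * a ^ 2 / 2 + (k a + L * a) * (b - a) ≤ primF k b + L * b ^ 2 / 2 := by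
  have h1 := primF_sub hk.cont a b
  have hc : Continuous (fun s => k s + L * s) := hk.cont.add (continuous_const.mul continuous_id)
  have e : ∫ s in a..b, (k s + L * s) = (∫ s in a..b, k s) + L * (b ^ 2 - a ^ 2) / 2 := by
    rw [intervalIntegral.integral_add (hk.cont.intervalIntegrable _ _)
      ((by fun_prop : Continuous fun s : ℝ => L * s).intervalIntegrable _ _), intervalIntegral.integral_const_mul,
      integral_id]; ring
  have h2 : (k a + L * a) * (b - a) ≤ ∫ s in a..b, (k s + L * s) := by
    rcases le_total a b with h | h
    · have := intervalIntegral.integral_mono_on h (continuous_const.intervalIntegrable (μ := volume) a b)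
        (hc.intervalIntegrable a b) (fun s hs => hk.mono a s ha hs.1)
      rw [intervalIntegral.integral_const, smul_eq_mul] at this
      linarith
    · have := intervalIntegral.integral_mono_on h (hc.intervalIntegrable b a)
        (continuous_const.intervalIntegrable (μ := volume) b a)
        (fun s hs => hk.mono s a (hb.trans hs.1) hs.2)
      rw [intervalIntegral.integral_const, smul_eq_mul] at this
      rw [intervalIntegral.integral_symm b a]
      linarith
  linarith

lemma NL.Fnn {k : ℝ → ℝ} {L : ℝ} (hk : NL k L) {t : ℝ} (ht : 0 ≤ t) : 0 ≤ primF k t :=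
  intervalIntegral.integral_nonneg ht fun s hs => hk.nn s hs.1

lemma NL.Fsub {k : ℝ → ℝ} {L : ℝ} (hk : NL k L) : SubC (primF k) := by
  refine ((hk.sub.add ((SubC_const L).mul SubC_id)).mul SubC_id).mono fun t ht => ?_
  rw [abs_of_nonneg (hk.Fnn ht), abs_of_nonneg]
  · have := intervalIntegral.integral_mono_on ht (hk.cont.intervalIntegrable 0 t)
      (continuous_const.intervalIntegrable (μ := volume) 0 t) (g := fun _ => k t + L * t)
      (fun s hs => by have := hk.mono s t hs.1 hs.2; nlinarith [hs.1, hk.Lp])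
    rw [intervalIntegral.integral_const, smul_eq_mul, sub_zero] at this
    unfold primF; linarith
  · have := hk.nn t ht; have := hk.Lp; positivity

lemma S_ex {k : ℝ → ℝ} {L : ℝ} (hk : NL k L) {u : ℝ → ℝ} (hu : KK u) :
    ∃ w, KK w ∧ ∀ v, memX' v → BL L w v = ∫ x, (k (u x) + L * u x) * v x ∂mu := by
  have hgc : Continuous (fun t => k t + L * t) := hk.cont.add (continuous_const.mul continuous_id)
  set h : ℝ → ℝ := indicator (Ioo (-1) 1) (fun x => k (u x) + L * u x) with hh
  have hg0 : ∀ x, 0 ≤ k (u x) + L * u x := fun x => by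
    have := hk.nn _ (hu.2.1 x); have := hk.Lp; have := hu.2.1 x; positivity
  have hhL : MemLp h 2 volume := (memLp_indicator_iff_restrict measurableSet_Ioo).2 (hu.mq hgc)
  obtain ⟨w, hw, heq⟩ := res_K hk.Lp hhL (fun x => indicator_nonneg (fun x _ => hg0 x) x) (fun x y hxy => by
    by_cases hy : y ∈ Ioo (-1 : ℝ) 1
    · have hx : x ∈ Ioo (-1 : ℝ) 1 := abs_lt.1 (hxy.trans_lt (abs_lt.2 hy))
      rw [hh, indicator_of_mem hy, indicator_of_mem hx]
      exact hk.mono _ _ (hu.2.1 y) (hu.2.2 x y hxy)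
    · rw [hh, indicator_of_notMem hy]
      exact indicator_nonneg (fun x _ => hg0 x) x)
  refine ⟨w, hw, fun v hv => ?_⟩
  have := heq v hv
  rw [← set_int_eq hv.off, ← set_int_eq hv.off] at this
  unfold BL mu
  rw [this]
  refine setIntegral_congr_fun measurableSet_Ioo fun x hx => ?_
  simp only [hh, indicator_of_mem hx]

lemma descent {k : ℝ → ℝ} {L : ℝ} (hk : NL k L) {u w : ℝ → ℝ} (hu : KK u) (hw : KK w)
    (heq : ∀ v, memX' v → BL L w v = ∫ x, (k (u x) + L * u x) * v x ∂mu)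
    {s : ℝ} (hs0 : 0 ≤ s) (hs1 : s ≤ 1) :
    KK (fun x => u x + s * (w x - u x)) ∧ JJ k (fun x => u x + s * (w x - u x)) ≤
      JJ k u - (s - s ^ 2 / 2) * BL L (fun x => w x - u x) (fun x => w x - u x) := by
  set z : ℝ → ℝ := fun x => w x - u x with hz
  have hzX : memX' z := hw.1.sub hu.1
  set b : ℝ → ℝ := fun x => u x + s * z x with hb
  have hbK : KK b := by
    have := hu.comb hw (sub_nonneg.2 hs1) hs0
    convert this using 1; funext x; simp only [hb, hz]; ring
  refine ⟨hbK, ?_⟩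
  have hFc := primF_cont hk.cont
  have J2 : ∀ {v : ℝ → ℝ}, KK v → JJ k v = BL L v v / 2 - ∫ x, (primF k (v x) + L * v x ^ 2 / 2) ∂mu := by
    intro v hv
    have : ∫ x, (primF k (v x) + L * v x ^ 2 / 2) ∂mu = ∫ x, primF k (v x) ∂mu + L / 2 * ∫ x, v x * v x ∂mu := by
      rw [← integral_const_mul, ← integral_add (hv.iq hFc) ((hv.1.mmul hv.1).const_mul _)]
      congr 1; funext x; ring
    rw [this, JJ, BL, gagSq_eq]; ring
  have iG : ∀ {v : ℝ → ℝ}, KK v → Integrable (fun x => primF k (v x) + L * v x ^ 2 / 2) mu := fun hv =>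
    hv.iq (q := fun t => primF k t + L * t ^ 2 / 2) (by fun_prop)
  have hgc : Continuous (fun t => k t + L * t) := hk.cont.add (continuous_const.mul continuous_id)
  have ig := hu.iqv hgc hzX
  have c1 : ∫ x, (primF k (u x) + L * u x ^ 2 / 2) ∂mu + s * BL L w z
      ≤ ∫ x, (primF k (b x) + L * b x ^ 2 / 2) ∂mu := by
    rw [heq z hzX, ← integral_const_mul, ← integral_add (iG hu) (ig.const_mul s)]
    refine integral_mono ((iG hu).add (ig.const_mul s)) (iG hbK) fun x => ?_
    have := hk.conv (hu.2.1 x) (hbK.2.1 x)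
    simp only [hb] at this ⊢
    linarith
  have e1 := BL_exp L hu.1 hzX s
  have e2 : BL L z z = BL L w z - BL L u z := BL_sub_left L hw.1 hu.1 hzX
  rw [J2 hbK, J2 hu]
  have e3 : BL L b b = BL L u u + 2 * s * BL L u z + s ^ 2 * BL L z z := e1
  rw [e3]
  nlinarith

lemma S_cont {ω : ℝ} (hω : 0 < ω) (hTM : TMprop' ω) (hl : 0 < lam1') {k : ℝ → ℝ} {L : ℝ} (hk : NL k L)
    {S : (ℝ → ℝ) → ℝ → ℝ} (hS : ∀ u, KK u → KK (S u) ∧ ∀ v, memX' v → BL L (S u) v = ∫ x, (k (u x) + L * u x) * v x ∂mu)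
    {u : ℕ → ℝ → ℝ} {v : ℝ → ℝ} (hu : ∀ n, KK (u n)) (hv : KK v)
    (hlim : Tendsto (fun n => gagSq (fun x => u n x - v x)) atTop (𝓝 0)) :
    Tendsto (fun n => gagSq (fun x => S (u n) x - S v x)) atTop (𝓝 0) := by
  have hgc : Continuous (fun t => k t + L * t) := hk.cont.add (continuous_const.mul continuous_id)
  have h1 := CONT hω hTM hl hgc (hk.sub.add ((SubC_const L).mul SubC_id)) hu hv hlim
  have h2 := h1.const_mul (2 * π / (4 * L))
  rw [mul_zero] at h2
  have hL := hk.Lp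
  have hπ := Real.pi_pos
  refine squeeze_zero (fun n => gagSq_nonneg _) (fun n => ?_) h2
  set d : ℝ → ℝ := fun x => S (u n) x - S v x with hd
  have hdX : memX' d := (hS _ (hu n)).1.1.sub (hS _ hv).1.1
  have e : BL L d d = ∫ x, ((k (u n x) + L * u n x) - (k (v x) + L * v x)) * d x ∂mu := by
    rw [hd, BL_sub_left L (hS _ (hu n)).1.1 (hS _ hv).1.1 hdX, (hS _ (hu n)).2 _ hdX, (hS _ hv).2 _ hdX,
      ← integral_sub ((hu n).iqv hgc hdX) (hv.iqv hgc hdX)]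
    congr 1; funext x; ring
  have i1 : MemLp (fun x => (k (u n x) + L * u n x) - (k (v x) + L * v x)) 2 mu :=
    ((hu n).mq hgc).sub (hv.mq hgc)
  have b : BL L d d ≤ 1 / (4 * L) * ∫ x, ((k (u n x) + L * u n x) - (k (v x) + L * v x)) ^ 2 ∂mu
      + L * ∫ x, d x * d x ∂mu := by
    rw [e, ← integral_const_mul, ← integral_const_mul,
      ← integral_add (i1.integrable_sq.const_mul _) ((hdX.mmul hdX).const_mul _)]
    refine integral_mono (i1.integrable_mul hdX.mLp)
      ((i1.integrable_sq.const_mul _).add ((hdX.mmul hdX).const_mul _)) fun x => ?_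
    show _ ≤ _
    set a := (k (u n x) + L * u n x) - (k (v x) + L * v x)
    have : 1 / (4 * L) * a ^ 2 + L * (d x * d x) - a * d x = (a - 2 * L * d x) ^ 2 / (4 * L) := by
      field_simp; ring
    have h5 : 0 ≤ (a - 2 * L * d x) ^ 2 / (4 * L) := by positivity
    linarith
  rw [BL, ← gagSq_eq] at b
  have b2 : gagSq d / (2 * π) ≤ 1 / (4 * L) * ∫ x, ((k (u n x) + L * u n x) - (k (v x) + L * v x)) ^ 2 ∂mu := by
    linarith
  rw [div_le_iff₀ (by positivity)] at b2
  refine b2.trans (le_of_eq ?_)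
  ring

lemma J_cont {ω : ℝ} (hω : 0 < ω) (hTM : TMprop' ω) (hl : 0 < lam1') {k : ℝ → ℝ} {L : ℝ} (hk : NL k L)
    {u : ℕ → ℝ → ℝ} {v : ℝ → ℝ} (hu : ∀ n, KK (u n)) (hv : KK v)
    (hlim : Tendsto (fun n => gagSq (fun x => u n x - v x)) atTop (𝓝 0)) :
    Tendsto (fun n => JJ k (u n)) atTop (𝓝 (JJ k v)) := by
  have hFc := primF_cont hk.cont
  have h1 := CONT hω hTM hl hFc hk.Fsub hu hv hlim
  refine ((gag_cont (fun n => (hu n).1) hv.1 hlim).div_const _).sub ?_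
  rw [tendsto_iff_norm_sub_tendsto_zero]
  have h2 : Tendsto (fun n => √(mu.real univ * ∫ x, (primF k (u n x) - primF k (v x)) ^ 2 ∂mu)) atTop (𝓝 0) := by
    have := (Real.continuous_sqrt.tendsto _).comp (h1.const_mul (mu.real univ))
    rw [mul_zero, Real.sqrt_zero] at this
    exact this
  refine squeeze_zero (fun n => norm_nonneg _) (fun n => ?_) h2
  rw [norm_eq_abs]
  apply Real.abs_le_sqrt
  have i1 : MemLp (fun x => primF k (u n x) - primF k (v x)) 2 mu := ((hu n).mq hFc).sub (hv.mq hFc)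
  rw [← integral_sub ((hu n).iq hFc) (hv.iq hFc)]
  have i2 : Integrable (fun x => primF k (u n x) - primF k (v x)) mu := i1.integrable (by norm_num)
  have := discrim_le_zero (a := mu.real univ) (b := 2 * ∫ x, (primF k (u n x) - primF k (v x)) ∂mu)
    (c := ∫ x, (primF k (u n x) - primF k (v x)) ^ 2 ∂mu) (fun s => by
      have h0 : 0 ≤ ∫ x, (s + (primF k (u n x) - primF k (v x))) ^ 2 ∂mu := integral_nonneg fun x => by positivity
      have e : ∫ x, (s + (primF k (u n x) - primF k (v x))) ^ 2 ∂mu = s ^ 2 * mu.real univ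
          + 2 * s * ∫ x, (primF k (u n x) - primF k (v x)) ∂mu + ∫ x, (primF k (u n x) - primF k (v x)) ^ 2 ∂mu := by
        have : s ^ 2 * mu.real univ = ∫ x, s ^ 2 ∂mu := by simp [mul_comm]
        rw [this, ← integral_const_mul, int3 (integrable_const _) (i2.const_mul _) i1.integrable_sq]
        congr 1; funext x; ring
      rw [e] at h0
      linarith)
  rw [discrim] at this
  linarith


lemma gag_sub_smul (a b : ℝ) (e : ℝ → ℝ) :
    gagSq (fun x => a * e x - b * e x) = (a - b) ^ 2 * gagSq e := by
  rw [← gagSq_smul]; congr 1; funext x; ring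

lemma mount {ω : ℝ} (hω : 0 < ω) (hTM : TMprop' ω) (hl : 0 < lam1') {k : ℝ → ℝ} {L : ℝ} (hk : NL k L)
    {r c C : ℝ} (hr : 0 < r) (hc : 0 < c)
    (hsb : ∀ u, KK u → gagSq u ≤ r → c * gagSq u ≤ JJ k u) {e : ℝ → ℝ} (he : KK e)
    (hneg : ∃ T, 0 ≤ T ∧ JJ k (fun x => T * e x) < 0) (hC : ∀ T, 0 ≤ T → JJ k (fun x => T * e x) ≤ C)
    {δ : ℝ} (hδ : 0 < δ) :
    ∃ u, KK u ∧ (r ≤ gagSq u ∨ c * r ≤ JJ k u) ∧ JJ k u ≤ C ∧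
      ∀ v, memX' v → |innerX u v / (2 * π) - ∫ x, k (u x) * v x ∂mu| ≤ δ * (1 + gagSq v) := by
  have hπ := Real.pi_pos
  have hL := hk.Lp
  choose! S hS using fun u (hu : KK u) => S_ex hk hu
  set U : ℕ → ℝ → ℝ → ℝ := fun m t => S^[m] (fun x => |t| * e x) with hU
  have hUs : ∀ m t, U (m + 1) t = S (U m t) := fun m t => Function.iterate_succ_apply' S m _
  have hUK : ∀ m t, KK (U m t) := by
    intro m t
    induction m with
    | zero =>
      have := he.comb he (abs_nonneg t) le_rfl
      simpa [hU] using this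
    | succ m ih => rw [hUs]; exact (hS _ ih).1
  have hUc : ∀ m (t : ℝ) (ts : ℕ → ℝ), Tendsto ts atTop (𝓝 t) →
      Tendsto (fun n => gagSq (fun x => U m (ts n) x - U m t x)) atTop (𝓝 0) := by
    intro m t ts hts
    induction m with
    | zero =>
      simp only [hU, Function.iterate_zero, id, gag_sub_smul]
      have h1 : Tendsto (fun n => |ts n|) atTop (𝓝 |t|) := hts.abs
      have := ((h1.sub_const |t|).pow 2).mul_const (gagSq e)
      simpa using this
    | succ m ih =>
      simp only [hUs]
      exact S_cont hω hTM hl hk hS (fun n => hUK m _) (hUK m t) ih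
  have hJc : ∀ m, Continuous (fun t => JJ k (U m t)) := fun m => by
    refine continuous_iff_seqContinuous.2 fun ts t hts => ?_
    exact J_cont hω hTM hl hk (fun n => hUK m _) (hUK m t) (hUc m t ts hts)
  have hGc : ∀ m, Continuous (fun t => gagSq (U m t)) := fun m => by
    refine continuous_iff_seqContinuous.2 fun ts t hts => ?_
    exact gag_cont (fun n => (hUK m _).1) (hUK m t).1 (hUc m t ts hts)
  have hdesc : ∀ u, KK u → JJ k (S u) ≤ JJ k u - 1 / 2 * BL L (fun x => S u x - u x) (fun x => S u x - u x) := by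
    intro u hu
    have := (descent hk hu (hS u hu).1 (hS u hu).2 zero_le_one le_rfl).2
    have e1 : (fun x => u x + 1 * (S u x - u x)) = S u := by funext x; ring
    rw [e1] at this
    linarith
  have hJS : ∀ u, KK u → JJ k (S u) ≤ JJ k u := fun u hu => by
    have := hdesc u hu
    have := BL_nonneg hL.le (fun x => S u x - u x)
    linarith
  have hinv : ∀ u, KK u → gagSq u < r → JJ k u < c * r → gagSq (S u) < r := by
    intro u hu h1 h2
    by_contra! h3
    have hzX := (hS u hu).1.1.sub hu.1
    have hcont : Continuous (fun s : ℝ => gagSq (fun x => u x + s * (S u x - u x))) := by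
      simp only [gag_exp hu.1 hzX]; fun_prop
    have e0 : gagSq (fun x => u x + 0 * (S u x - u x)) = gagSq u := by congr 1; funext x; ring
    have e1 : gagSq (fun x => u x + 1 * (S u x - u x)) = gagSq (S u) := by congr 1; funext x; ring
    obtain ⟨s, hs, hs2⟩ := intermediate_value_Icc (zero_le_one (α := ℝ)) hcont.continuousOn
      (show r ∈ Icc _ _ by rw [e0, e1]; exact ⟨h1.le, h3⟩)
    simp only at hs2
    obtain ⟨d1, d2⟩ := descent hk hu (hS u hu).1 (hS u hu).2 hs.1 hs.2
    have d3 := hsb _ d1 hs2.le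
    rw [hs2] at d3
    have := BL_nonneg hL.le (fun x => S u x - u x)
    have : 0 ≤ s - s ^ 2 / 2 := by nlinarith [hs.1, hs.2]
    have := mul_nonneg this (BL_nonneg hL.le (fun x => S u x - u x))
    linarith
  have hJm : ∀ m n t, m ≤ n → JJ k (U n t) ≤ JJ k (U m t) := by
    intro m n t hmn
    induction n, hmn using Nat.le_induction with
    | base => rfl
    | succ n _ ih => rw [hUs]; exact (hJS _ (hUK n t)).trans ih
  have hVm : ∀ m n t, m ≤ n → gagSq (U m t) < r → JJ k (U m t) < c * r → gagSq (U n t) < r := by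
    intro m n t hmn h1 h2
    induction n, hmn using Nat.le_induction with
    | base => exact h1
    | succ n hn ih => rw [hUs]; exact hinv _ (hUK n t) ih ((hJm m n t hn).trans_lt h2)
  set A : Set ℝ := ⋃ m, {t | gagSq (U m t) < r ∧ JJ k (U m t) < c * r} with hA
  set B : Set ℝ := ⋃ m, {t | JJ k (U m t) < 0} with hB
  have hAo : IsOpen A := isOpen_iUnion fun m =>
    (isOpen_lt (hGc m) continuous_const).inter (isOpen_lt (hJc m) continuous_const)
  have hBo : IsOpen B := isOpen_iUnion fun m => isOpen_lt (hJc m) continuous_const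
  have h0A : (0 : ℝ) ∈ A := by
    refine mem_iUnion.2 ⟨0, ?_⟩
    have e1 : U 0 0 = fun _ => 0 := by funext x; simp [hU]
    have e2 : gagSq (fun _ => 0) = 0 := by simp [gagSq, gagKer]
    have e3 : JJ k (fun _ => 0) = 0 := by simp [JJ, e2, primF]
    show gagSq (U 0 0) < r ∧ JJ k (U 0 0) < c * r
    rw [e1, e2, e3]
    exact ⟨hr, by positivity⟩
  obtain ⟨T, hT0, hT⟩ := hneg
  have hTB : T ∈ B := by
    refine mem_iUnion.2 ⟨0, ?_⟩
    show JJ k (U 0 T) < 0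
    simpa [hU, abs_of_nonneg hT0] using hT
  have hdis : ∀ t, t ∈ A → t ∈ B → False := by
    intro t htA htB
    obtain ⟨m, h1, h2⟩ := mem_iUnion.1 htA
    obtain ⟨n, h3⟩ := mem_iUnion.1 htB
    have a1 := hVm m (max m n) t (le_max_left _ _) h1 h2
    have a2 := hJm n (max m n) t (le_max_right _ _)
    have a3 := hsb _ (hUK (max m n) t) a1.le
    have a4 := mul_nonneg hc.le (gagSq_nonneg (U (max m n) t))
    have h3' : JJ k (U n t) < 0 := h3
    linarith
  obtain ⟨t, ht⟩ : ∃ t, t ∉ A ∪ B := by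
    by_contra! hcon
    obtain ⟨t, -, h1, h2⟩ := isPreconnected_univ A B hAo hBo (fun x _ => hcon x) ⟨0, trivial, h0A⟩ ⟨T, trivial, hTB⟩
    exact hdis t h1 h2
  have htA : ∀ m, gagSq (U m t) < r → c * r ≤ JJ k (U m t) := fun m hm => by
    by_contra! h; exact ht (Or.inl (mem_iUnion.2 ⟨m, hm, h⟩))
  have htB : ∀ m, 0 ≤ JJ k (U m t) := fun m => by
    by_contra! h; exact ht (Or.inr (mem_iUnion.2 ⟨m, h⟩))
  set D := 1 / (2 * π) + L / lam1' with hD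
  have hD0 : 0 < D := by positivity
  set ε := δ / (1 + D) with hε
  have hε0 : 0 < ε := by positivity
  obtain ⟨m, hm⟩ : ∃ m, BL L (fun x => S (U m t) x - U m t x) (fun x => S (U m t) x - U m t x) ≤ ε ^ 2 := by
    by_contra! hcon
    have : ∀ m : ℕ, JJ k (U m t) ≤ JJ k (U 0 t) - m * (ε ^ 2 / 2) := by
      intro m
      induction m with
      | zero => simp
      | succ m ih =>
        have h1 := hdesc _ (hUK m t)
        have h2 := hcon m
        rw [hUs]; push_cast; linarith
    obtain ⟨m, hm⟩ := exists_nat_gt (JJ k (U 0 t) / (ε ^ 2 / 2))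
    rw [div_lt_iff₀ (by positivity)] at hm
    have := this m
    have := htB m
    linarith
  refine ⟨U m t, hUK m t, ?_, ?_, fun v hv => ?_⟩
  · rcases lt_or_ge (gagSq (U m t)) r with h | h
    · exact Or.inr (htA m h)
    · exact Or.inl h
  · refine (hJm 0 m t (Nat.zero_le _)).trans ?_
    exact hC |t| (abs_nonneg t)
  · set u := U m t with hu
    set z : ℝ → ℝ := fun x => S u x - u x with hz
    have huK : KK u := hUK m t
    have hzX : memX' z := (hS u huK).1.1.sub huK.1
    have e1 : BL L z v = ∫ x, k (u x) * v x ∂mu - innerX u v / (2 * π) := by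
      rw [hz, BL_sub_left L (hS u huK).1.1 huK.1 hv, (hS u huK).2 v hv, BL]
      have : ∫ x, (k (u x) + L * u x) * v x ∂mu = ∫ x, k (u x) * v x ∂mu + L * ∫ x, u x * v x ∂mu := by
        rw [← integral_const_mul, ← integral_add (huK.iqv hk.cont hv) ((huK.1.mmul hv).const_mul _)]
        congr 1; funext x; ring
      rw [this]; ring
    have b1 := BL_nonneg hL.le (fun x => z x + ε * v x)
    have b2 := BL_nonneg hL.le (fun x => z x + (-ε) * v x)
    rw [BL_exp L hzX hv] at b1 b2
    have b3 : BL L v v ≤ D * gagSq v := by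
      rw [BL, ← gagSq_eq, hD]
      have := mu_poinc hv
      have h2 : ∫ x, v x * v x ∂mu ≤ gagSq v / lam1' := by
        rw [le_div_iff₀ hl, mul_comm]; simpa only [sq] using this
      have := mul_le_mul_of_nonneg_left h2 hL.le
      calc _ ≤ gagSq v / (2 * π) + L * (gagSq v / lam1') := by linarith
        _ = _ := by ring
    have hg := gagSq_nonneg v
    have hδε : δ = ε * (1 + D) := by rw [hε]; field_simp
    have b4 : |BL L z v| ≤ ε / 2 * (1 + BL L v v) := by
      rw [abs_le]
      constructor
      · have : 0 ≤ ε * (ε / 2 * (1 + BL L v v) + BL L z v) := by nlinarith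
        have := nonneg_of_mul_nonneg_right this hε0
        linarith
      · have : 0 ≤ ε * (ε / 2 * (1 + BL L v v) - BL L z v) := by nlinarith
        have := nonneg_of_mul_nonneg_right this hε0
        linarith
    rw [← abs_neg, neg_sub, ← e1]
    refine b4.trans ?_
    rw [hδε]
    have : ε / 2 * (1 + BL L v v) ≤ ε / 2 * (1 + D * gagSq v) := by gcongr
    refine this.trans ?_
    have h5 : 0 ≤ ε * gagSq v := by positivity
    have h6 : 0 ≤ ε * D := by positivity
    have h7 : 0 ≤ ε * D * gagSq v := by positivity
    nlinarith


lemma primF_le {k f : ℝ → ℝ} (hk : Continuous k) (hf : Continuous f) (h : ∀ t, 0 ≤ t → k t ≤ f t)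
    {t : ℝ} (ht : 0 ≤ t) : primF k t ≤ primF f t :=
  intervalIntegral.integral_mono_on ht (hk.intervalIntegrable 0 t) (hf.intervalIntegrable 0 t)
    fun s hs => h s hs.1

lemma F_mono {f : ℝ → ℝ} (hf : Continuous f) (h : ∀ t, 0 < t → 2 * primF f t ≤ f t * t)
    {s t : ℝ} (hs : 0 < s) (hst : s ≤ t) : primF f s / s ^ 2 ≤ primF f t / t ^ 2 := by
  have hd : ∀ x, 0 < x → HasDerivAt (fun t => primF f t / t ^ 2)
      ((f x * x ^ 2 - primF f x * (2 * x)) / (x ^ 2) ^ 2) x := fun x hx => by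
    have h1 : HasDerivAt (primF f) (f x) x :=
      intervalIntegral.integral_hasDerivAt_right (hf.intervalIntegrable 0 x)
        (hf.stronglyMeasurableAtFilter _ _) hf.continuousAt
    have h2 : HasDerivAt (fun t : ℝ => t ^ 2) (2 * x) x := by simpa using hasDerivAt_pow 2 x
    exact h1.div h2 (by positivity)
  have hm : MonotoneOn (fun t => primF f t / t ^ 2) (Ioi 0) := by
    refine monotoneOn_of_deriv_nonneg (convex_Ioi 0)
      (fun x hx => (hd x hx).continuousAt.continuousWithinAt)
      (fun x hx => ?_) (fun x hx => ?_)
    · rw [interior_Ioi] at hx; exact (hd x hx).differentiableAt.differentiableWithinAt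
    · rw [interior_Ioi] at hx
      have hx' : 0 < x := hx
      rw [(hd x hx).deriv]
      apply div_nonneg _ (by positivity)
      have := h x hx
      nlinarith
  exact hm hs (hs.trans_le hst) hst

structure FF (f : ℝ → ℝ) (M R a τ : ℝ) : Prop where
  cont : Continuous f
  nn : ∀ t, 0 ≤ t → 0 ≤ f t
  f0 : f 0 = 0
  sub : SubC f
  lam : 0 < lam1'
  two : ∀ t, 0 < t → 0 < primF f t ∧ 2 * primF f t ≤ f t * t
  Mp : 0 < M
  Rp : 0 < R
  RM : 3 * M ≤ R
  ar : ∀ t, R ≤ t → primF f t ≤ M * f t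
  a0 : 0 ≤ a
  al : a < lam1' / (4 * π)
  τp : 0 < τ
  sm : ∀ t, 0 ≤ t → t ≤ τ → primF f t ≤ a * t ^ 2

lemma FF_of_HypH {f : ℝ → ℝ} (hf : HypH f) : ∃ M R a τ, FF f M R a τ := by
  obtain ⟨hc, h0, ⟨t₀, ht₀, M, hM, hMR⟩, h2, hls, hsub⟩ := hf
  have hπ := Real.pi_pos
  have hpos : ∀ t, 0 < t → 0 < f t := fun t ht => by
    have := h2 t ht.ne'
    have h3 : 0 < f t * t := by linarith
    exact pos_of_mul_pos_left h3 ht.le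
  have hnn : ∀ t, 0 ≤ t → 0 ≤ f t := fun t ht => by
    rcases ht.eq_or_lt with h | h
    · rw [← h, h0]
    · exact (hpos t h).le
  have hF0 : ∀ t, t ≠ 0 → 0 < primF f t := fun t ht => by linarith [(h2 t ht).1]
  have m1 := fun {s t : ℝ} (hs : 0 < s) (hst : s ≤ t) => F_mono hc (fun t ht => (h2 t ht.ne').2) hs hst
  have e2 : ∀ t, primF (fun t => - f (-t)) t = primF f (-t) := fun t => by
    unfold primF
    rw [intervalIntegral.integral_neg, intervalIntegral.integral_comp_neg, neg_zero,
      ← intervalIntegral.integral_symm]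
  have m2 : ∀ {s t : ℝ}, 0 < s → s ≤ t → primF f (-s) / s ^ 2 ≤ primF f (-t) / t ^ 2 := by
    intro s t hs hst
    have := F_mono (f := fun t => - f (-t)) (by fun_prop) (fun t ht => by
      rw [e2]; have := (h2 (-t) (by linarith)).2; linarith) hs hst
    rwa [e2, e2] at this
  set φ : ℝ → ℝ := fun t => primF f t / t ^ 2 with hφ
  have hb : ∀ᶠ t in 𝓝[≠] (0 : ℝ), φ t ≤ max (primF f 1) (primF f (-1)) := by
    have : Ioo (-1 : ℝ) 1 ∈ 𝓝[≠] (0 : ℝ) := mem_nhdsWithin_of_mem_nhds (Ioo_mem_nhds (by norm_num) (by norm_num))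
    filter_upwards [this, self_mem_nhdsWithin] with t ht ht0
    rcases lt_or_gt_of_ne ht0 with h | h
    · have := m2 (s := -t) (t := 1) (by linarith) (by linarith [ht.1])
      simp only [neg_neg, one_pow, div_one, neg_sq] at this
      exact this.trans (le_max_right _ _)
    · have := m1 h ht.2.le
      simp only [one_pow, div_one] at this
      exact this.trans (le_max_left _ _)
  have hφ0 : ∀ t, 0 ≤ φ t := fun t => by
    by_cases ht : t = 0
    · simp [hφ, ht]
    · have := hF0 t ht; simp only [hφ]; positivity
  have hls0 : 0 ≤ limsup φ (𝓝[≠] (0 : ℝ)) := by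
    rw [limsup_eq]
    refine Real.sInf_nonneg fun a ha => ?_
    have ha' : ∀ᶠ t in 𝓝[≠] (0 : ℝ), φ t ≤ a := ha
    obtain ⟨t, ht⟩ := ha'.exists
    exact (hφ0 t).trans ht
  obtain ⟨a, ha1, ha2⟩ := exists_between hls
  have hl : 0 < lam1' := by
    have : 0 < lam1' / (4 * π) := hls0.trans_lt hls
    have h4 : 0 < 4 * π := by positivity
    exact (div_pos_iff_of_pos_right h4).1 this
  have hev : ∀ᶠ t in 𝓝[≠] (0 : ℝ), φ t < a :=
    eventually_lt_of_limsup_lt ha1 ⟨_, hb⟩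
  have hev2 : ∀ᶠ t in 𝓝[>] (0 : ℝ), φ t < a := hev.filter_mono (nhdsWithin_mono _ fun x hx => (ne_of_gt hx))
  obtain ⟨τ, hτ, hτ2⟩ := (mem_nhdsGT_iff_exists_Ioc_subset).1 hev2
  refine ⟨M, max t₀ (3 * M), a, τ, hc, hnn, h0, ?_, hl, fun t ht => ⟨hF0 t ht.ne', (h2 t ht.ne').2⟩, hM,
    lt_max_of_lt_left ht₀, le_max_right _ _, fun t ht => ?_, hls0.trans ha1.le, ha2, hτ, fun t ht htτ => ?_⟩
  · intro α hα
    have h3 := (hsub α hα).eventually (gt_mem_nhds one_pos)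
    rw [Filter.eventually_iff, Filter.mem_cocompact] at h3
    obtain ⟨K, hK, hK2⟩ := h3
    obtain ⟨C, hC⟩ := hK.exists_bound_of_continuousOn hc.continuousOn
    refine ⟨max C 1, by positivity, fun t _ => ?_⟩
    have he : 1 ≤ exp (α * t ^ 2) := one_le_exp (by positivity)
    by_cases ht : t ∈ K
    · have h4 : |f t| ≤ C := hC t ht
      have := le_max_left C 1
      have := le_max_right C 1
      nlinarith
    · have h4 : |f t| * exp (-α * t ^ 2) < 1 := hK2 ht
      rw [neg_mul, exp_neg, ← div_eq_mul_inv, div_lt_one (exp_pos _)] at h4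
      have := le_max_right C 1
      nlinarith
  · have htt : t₀ ≤ t := (le_max_left _ _).trans ht
    have ht0 : 0 < t := ht₀.trans_le htt
    have := (hMR t (by rw [abs_of_pos ht0]; exact htt)).2
    rwa [abs_of_pos (hpos t ht0)] at this
  · rcases ht.eq_or_lt with h | h
    · rw [← h]; simp [primF]
    · have : φ t < a := hτ2 ⟨h, htτ⟩
      simp only [hφ] at this
      rw [div_lt_iff₀ (by positivity)] at this
      exact this.le

def fpos (f : ℝ → ℝ) (L σ : ℝ) : ℝ := f (max σ 0) + L * max σ 0

def kreg (f : ℝ → ℝ) (L t : ℝ) : ℝ := sInf (fpos f L '' Ici t) - L * max t 0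

section reg
variable {f : ℝ → ℝ} {M R a τ : ℝ}

lemma FF.bb (h : FF f M R a τ) {L : ℝ} (hL : 0 < L) (t : ℝ) : BddBelow (fpos f L '' Ici t) := by
  refine ⟨0, ?_⟩
  rintro _ ⟨σ, -, rfl⟩
  have := h.nn (max σ 0) (le_max_right _ _)
  have : 0 ≤ max σ 0 := le_max_right _ _
  unfold fpos; positivity

lemma FF.kle (h : FF f M R a τ) {L : ℝ} (hL : 0 < L) {t s : ℝ} (ht : 0 ≤ t) (hs : t ≤ s) :
    kreg f L t ≤ f s + L * (s - t) := by
  have := csInf_le (h.bb hL t) ⟨s, hs, rfl⟩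
  unfold kreg
  rw [fpos, max_eq_left (ht.trans hs)] at this
  rw [max_eq_left ht]; linarith

lemma FF.le_k (_h : FF f M R a τ) {L c : ℝ} {t : ℝ} (ht : 0 ≤ t)
    (hc : ∀ s, t ≤ s → c ≤ f s + L * (s - t)) : c ≤ kreg f L t := by
  unfold kreg
  rw [le_sub_iff_add_le, max_eq_left ht]
  refine le_csInf ⟨_, t, self_mem_Ici, rfl⟩ ?_
  rintro _ ⟨s, hs, rfl⟩
  have := hc s hs
  rw [fpos, max_eq_left (ht.trans hs)]; linarith

lemma FF.k_cont (h : FF f M R a τ) {L : ℝ} (hL : 0 < L) : Continuous (kreg f L) := by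
  have hφ : Continuous (fpos f L) := by
    unfold fpos; have := h.cont; fun_prop
  have hG : Continuous (fun t => sInf (fpos f L '' Ici t)) := by
    have hmono : ∀ s t, s ≤ t → sInf (fpos f L '' Ici s) ≤ sInf (fpos f L '' Ici t) := fun s t hst =>
      csInf_le_csInf (h.bb hL s) ⟨_, t, self_mem_Ici, rfl⟩ (image_mono (Ici_subset_Ici.2 hst))
    rw [Metric.continuous_iff]
    intro t ε hε
    obtain ⟨δ, hδ, hδ2⟩ := Metric.continuous_iff.1 hφ t (ε / 4) (by positivity)
    have key : ∀ s s', dist s t < δ → dist s' t < δ → s ≤ s' →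
        sInf (fpos f L '' Ici s') ≤ sInf (fpos f L '' Ici s) + ε / 2 := by
      intro s s' hs hs' hss
      rw [← sub_le_iff_le_add]
      refine le_csInf ⟨_, s, self_mem_Ici, rfl⟩ ?_
      rintro _ ⟨σ, hσ, rfl⟩
      rcases le_total s' σ with hc | hc
      · have := csInf_le (h.bb hL s') ⟨σ, hc, rfl⟩
        linarith
      · have h1 := csInf_le (h.bb hL s') ⟨s', self_mem_Ici, rfl⟩
        have h2 := hδ2 s' hs'
        have h3 : dist σ t < δ := by
          rw [Real.dist_eq, abs_lt] at *
          have : s ≤ σ := hσ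
          constructor <;> linarith [hs.1, hs'.2]
        have h4 := hδ2 σ h3
        rw [Real.dist_eq, abs_lt] at h2 h4
        linarith [h2.2, h4.1]
    refine ⟨δ, hδ, fun s hs => ?_⟩
    have htt : dist t t < δ := by simpa using hδ
    rw [Real.dist_eq, abs_lt]
    rcases le_total s t with hc | hc
    · have := hmono s t hc; have := key s t hs htt hc; constructor <;> linarith
    · have := hmono t s hc; have := key t s htt hs hc; constructor <;> linarith
  unfold kreg
  exact hG.sub (by fun_prop)

lemma FF.k_lef (h : FF f M R a τ) {L : ℝ} (hL : 0 < L) {t : ℝ} (ht : 0 ≤ t) : kreg f L t ≤ f t := by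
  have := h.kle hL ht le_rfl
  simpa using this

lemma FF.k_nn (h : FF f M R a τ) {L : ℝ} (hL : 0 < L) {t : ℝ} (ht : 0 ≤ t) : 0 ≤ kreg f L t :=
  h.le_k ht fun s hs => by
    have := h.nn s (ht.trans hs)
    have : 0 ≤ L * (s - t) := mul_nonneg hL.le (by linarith)
    linarith

lemma FF.nl (h : FF f M R a τ) {L : ℝ} (hL : 0 < L) : NL (kreg f L) L where
  cont := h.k_cont hL
  nn := fun t ht => h.k_nn hL ht
  mono := fun s t hs hst => by
    have : sInf (fpos f L '' Ici s) ≤ sInf (fpos f L '' Ici t) :=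
      csInf_le_csInf (h.bb hL s) ⟨_, t, self_mem_Ici, rfl⟩ (image_mono (Ici_subset_Ici.2 hst))
    unfold kreg
    rw [max_eq_left hs, max_eq_left (hs.trans hst)]; linarith
  sub := h.sub.mono fun t ht => by
    rw [abs_of_nonneg (h.k_nn hL ht), abs_of_nonneg (h.nn t ht)]; exact h.k_lef hL ht
  Lp := hL

lemma FF.F_le (h : FF f M R a τ) {s t : ℝ} (hs : 0 ≤ s) (hst : s ≤ t) : primF f s ≤ primF f t := by
  have := primF_sub h.cont s t
  have h2 : 0 ≤ ∫ x in s..t, f x := intervalIntegral.integral_nonneg hst fun x hx => h.nn x (hs.trans hx.1)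
  linarith

lemma FF.k_ge (h : FF f M R a τ) {L : ℝ} (hL : 0 < L) {t : ℝ} (ht : R ≤ t) : primF f t / M ≤ kreg f L t := by
  have ht0 : 0 ≤ t := h.Rp.le.trans ht
  refine h.le_k ht0 fun s hs => ?_
  have h1 := h.ar s (ht.trans hs)
  have h2 := h.F_le ht0 hs
  have : 0 ≤ L * (s - t) := mul_nonneg hL.le (by linarith)
  rw [div_le_iff₀ h.Mp]
  nlinarith [h.Mp]

lemma FF.k_ar (h : FF f M R a τ) {L : ℝ} (hL : 0 < L) {t : ℝ} (ht : 0 ≤ t) :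
    primF (kreg f L) t ≤ kreg f L t * t / 3 + primF f R := by
  have h1 := primF_le (h.k_cont hL) h.cont (fun t ht => h.k_lef hL ht) ht
  have h0 := h.k_nn hL ht
  rcases le_total t R with hc | hc
  · have := h.F_le ht hc
    have : 0 ≤ kreg f L t * t / 3 := by positivity
    linarith
  · have h3 := h.k_ge hL hc
    have h4 := h.RM
    have h5 := (h.two R h.Rp).1
    rw [div_le_iff₀ h.Mp] at h3
    nlinarith

lemma FF.k_cube (h : FF f M R a τ) : ∃ c > 0, ∀ L, 0 < L → ∀ t, 0 ≤ t →
    c * (t ^ 3 - R ^ 3) ≤ primF (kreg f L) t := by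
  have hR := h.Rp
  have hM := h.Mp
  have hF := (h.two R h.Rp).1
  refine ⟨primF f R / R ^ 2 / M / 3, by positivity, fun L hL t ht => ?_⟩
  rcases le_total t R with hc | hc
  · have : t ^ 3 ≤ R ^ 3 := by gcongr
    have h2 := (h.nl hL).Fnn ht
    have : primF f R / R ^ 2 / M / 3 * (t ^ 3 - R ^ 3) ≤ 0 :=
      mul_nonpos_of_nonneg_of_nonpos (by positivity) (by linarith)
    linarith
  · have h1 := primF_sub (h.k_cont hL) R t
    have h2 := (h.nl hL).Fnn h.Rp.le
    have h3 : ∫ s in R..t, primF f R / R ^ 2 / M * s ^ 2 ≤ ∫ s in R..t, kreg f L s := by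
      refine intervalIntegral.integral_mono_on hc
        ((by fun_prop : Continuous fun s : ℝ => primF f R / R ^ 2 / M * s ^ 2).intervalIntegrable _ _)
        ((h.k_cont hL).intervalIntegrable _ _) fun s hs => ?_
      refine le_trans ?_ (h.k_ge hL hs.1)
      have := F_mono h.cont (fun t ht => (h.two t ht).2) h.Rp hs.1
      have hs0 : 0 < s := h.Rp.trans_le hs.1
      rw [le_div_iff₀ (by positivity)] at this
      rw [div_mul_eq_mul_div]
      gcongr
    rw [intervalIntegral.integral_const_mul, integral_pow] at h3
    norm_num at h3
    linarith

lemma FF.k_lim (h : FF f M R a τ) {t : ℕ → ℝ} {L : ℕ → ℝ} {s : ℝ} (ht0 : ∀ n, 0 ≤ t n) (hL0 : ∀ n, 0 < L n)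
    (ht : Tendsto t atTop (𝓝 s)) (hL : Tendsto L atTop atTop) :
    Tendsto (fun n => kreg f (L n) (t n)) atTop (𝓝 (f s)) := by
  have hup : Tendsto (fun n => f (t n)) atTop (𝓝 (f s)) := (h.cont.tendsto s).comp ht
  rw [Metric.tendsto_atTop] at *
  intro ε hε
  obtain ⟨δ, hδ, hδ2⟩ := Metric.continuous_iff.1 h.cont s (ε / 2) (by positivity)
  obtain ⟨N1, h1⟩ := hup ε hε
  obtain ⟨N2, h2⟩ := ht (δ / 2) (by positivity)
  obtain ⟨N3, h3⟩ := (tendsto_atTop_atTop.1 hL) (f s / (δ / 2))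
  refine ⟨max N1 (max N2 N3), fun n hn => ?_⟩
  have a1 := h1 n ((le_max_left _ _).trans hn)
  have a2 := h2 n ((le_max_left _ _).trans ((le_max_right _ _).trans hn))
  have a3 := h3 n ((le_max_right _ _).trans ((le_max_right _ _).trans hn))
  have b1 := h.k_lef (hL0 n) (ht0 n)
  have b2 : f s - ε / 2 ≤ kreg f (L n) (t n) := by
    refine h.le_k (ht0 n) fun σ hσ => ?_
    have c1 : 0 ≤ L n * (σ - t n) := mul_nonneg (hL0 n).le (by linarith)
    rw [Real.dist_eq, abs_lt] at a2
    rcases lt_or_ge (σ - t n) (δ / 2) with hc | hc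
    · have := hδ2 σ (by rw [Real.dist_eq, abs_lt]; constructor <;> linarith [a2.1, a2.2])
      rw [Real.dist_eq, abs_lt] at this
      linarith [this.1]
    · have h5 := h.nn σ ((ht0 n).trans hσ)
      rw [div_le_iff₀ (by positivity)] at a3
      have : L n * (δ / 2) ≤ L n * (σ - t n) := mul_le_mul_of_nonneg_left hc (hL0 n).le
      linarith
  rw [Real.dist_eq, abs_lt] at *
  constructor <;> linarith [a1.2]

end reg


section appr
variable {f : ℝ → ℝ} {M R a τ : ℝ}

lemma FF.small {ω : ℝ} (hω : 0 < ω) (hTM : TMprop' ω) (h : FF f M R a τ) :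
    ∃ r > 0, ∃ c > 0, ∀ L, 0 < L → ∀ u, KK u → gagSq u ≤ r → c * gagSq u ≤ JJ (kreg f L) u := by
  have hπ := Real.pi_pos
  have hl := h.lam
  have hτ := h.τp
  have hFc := primF_cont h.cont
  have hF0 : ∀ t, 0 ≤ t → 0 ≤ primF f t := fun t ht => by
    have := h.F_le le_rfl ht; simpa [primF] using this
  have hFs : SubC (primF f) := by
    refine (h.sub.mul SubC_id).mono fun t ht => ?_
    have h1 := h.nn t ht
    rw [abs_of_nonneg (hF0 t ht), abs_of_nonneg (by positivity)]
    rcases ht.eq_or_lt with h0 | h0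
    · rw [← h0]; simp [primF]
    · have := h.two t h0; linarith
  have hQs : SubC (fun t => ((t * t) * (t * t)) * primF f t) :=
    ((SubC_id.mul SubC_id).mul (SubC_id.mul SubC_id)).mul hFs
  have hQc : Continuous (fun t => ((t * t) * (t * t)) * primF f t) := by fun_prop
  obtain ⟨C, hC0, hC⟩ := TMb hω hTM hQs 1 zero_le_one
  set d := 1 / (4 * π) - a / lam1' with hd
  have hd0 : 0 < d := by
    rw [hd, sub_pos, div_lt_div_iff₀ hl (by positivity)]
    have := h.al
    rw [lt_div_iff₀ (by positivity)] at this
    linarith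
  refine ⟨min 1 (d / 2 * τ ^ 4 / (C + 1)), by positivity, d / 2, by positivity, fun L hL u hu hg => ?_⟩
  have hk := h.nl hL
  have hg1 : gagSq u ≤ 1 := hg.trans (min_le_left _ _)
  have hg2 : gagSq u ≤ d / 2 * τ ^ 4 / (C + 1) := hg.trans (min_le_right _ _)
  have hg0 := gagSq_nonneg u
  have hP := mu_poinc hu.1
  have hsq0 : 0 ≤ ∫ x, u x ^ 2 ∂mu := integral_nonneg fun x => by positivity
  have hkF : ∫ x, primF (kreg f L) (u x) ∂mu ≤ ∫ x, primF f (u x) ∂mu :=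
    integral_mono (hu.iq (primF_cont hk.cont)) (hu.iq hFc) fun x =>
      primF_le hk.cont h.cont (fun t ht => h.k_lef hL ht) (hu.2.1 x)
  rcases hg0.eq_or_lt with h0 | h0
  · have hz : ∫ x, u x ^ 2 ∂mu = 0 := by
      refine le_antisymm ?_ hsq0
      by_contra! hcon
      nlinarith
    rw [integral_eq_zero_iff_of_nonneg (fun x => by positivity) hu.1.msq] at hz
    have : ∫ x, primF f (u x) ∂mu = 0 := by
      rw [integral_eq_zero_of_ae]
      filter_upwards [hz] with x hx
      have : u x = 0 := by simpa using hx
      simp [this, primF]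
    rw [JJ, ← h0]; simp; linarith
  · have b1 : ∫ x, primF f (u x) ∂mu ≤ a * ∫ x, u x ^ 2 ∂mu
        + 1 / τ ^ 4 * ∫ x, ((u x * u x) * (u x * u x)) * primF f (u x) ∂mu := by
      rw [← integral_const_mul, ← integral_const_mul,
        ← integral_add (hu.1.msq.const_mul _) ((hu.iq hQc).const_mul _)]
      refine integral_mono (hu.iq hFc) ((hu.1.msq.const_mul _).add ((hu.iq hQc).const_mul _)) fun x => ?_
      show primF f (u x) ≤ a * u x ^ 2 + 1 / τ ^ 4 * ((u x * u x) * (u x * u x) * primF f (u x))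
      have hx := hu.2.1 x
      have hF := hF0 _ hx
      rcases le_total (u x) τ with hc | hc
      · have := h.sm _ hx hc
        have : 0 ≤ 1 / τ ^ 4 * ((u x * u x) * (u x * u x) * primF f (u x)) := by positivity
        linarith
      · have h3 : 0 ≤ a * u x ^ 2 := mul_nonneg h.a0 (by positivity)
        have h4 : τ ^ 4 ≤ u x ^ 4 := by gcongr
        have h5 : 1 ≤ 1 / τ ^ 4 * u x ^ 4 := by
          rw [one_div, inv_mul_eq_div, le_div_iff₀ (by positivity)]; linarith
        have h6 := mul_le_mul_of_nonneg_right h5 hF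
        nlinarith
    have b2 : ∫ x, ((u x * u x) * (u x * u x)) * primF f (u x) ∂mu ≤ gagSq u ^ 2 * C := by
      set ρ := √(gagSq u) with hρ
      have hρ0 : 0 < ρ := Real.sqrt_pos.2 h0
      have hρ2 : ρ ^ 2 = gagSq u := Real.sq_sqrt hg0
      have hρ1 : ρ ≤ 1 := by rw [hρ]; exact Real.sqrt_le_one.2 hg1
      set v : ℝ → ℝ := fun x => ρ⁻¹ * u x with hv
      have hvK : KK v := by
        have := hu.comb hu (inv_nonneg.2 hρ0.le) le_rfl
        simpa using this
      have hvg : gagSq v ≤ 1 := by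
        rw [hv, gagSq_smul, ← hρ2, inv_pow, inv_mul_cancel₀ (by positivity)]
      obtain ⟨i1, i2⟩ := hC v hvK.1 hvK.2.1 hvg (fun x => ((v x * v x) * (v x * v x)) * primF f (v x))
        (hQc.measurable.comp hvK.1.meas) (fun x => by
          have := hF0 _ (hvK.2.1 x); rw [abs_of_nonneg (mul_nonneg (mul_self_nonneg _) this)])
      have e1 : gagSq u ^ 2 * C ≥ gagSq u ^ 2 * ∫ x, ((v x * v x) * (v x * v x)) * primF f (v x) ∂mu := by
        have : ∫ x, ((v x * v x) * (v x * v x)) * primF f (v x) ∂mu ≤ C := by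
          refine le_trans (le_of_eq ?_) i2
          congr 1; funext x
          have := hF0 _ (hvK.2.1 x); rw [abs_of_nonneg (mul_nonneg (mul_self_nonneg _) this)]
        gcongr
      refine le_trans ?_ e1
      rw [← integral_const_mul]
      refine integral_mono (hu.iq hQc) (i1.const_mul _) fun x => ?_
      have eu : u x = ρ * v x := by simp only [hv]; field_simp
      have hvx := hvK.2.1 x
      have hF := h.F_le (hu.2.1 x) (show u x ≤ v x by rw [eu]; nlinarith)
      show ((u x * u x) * (u x * u x)) * primF f (u x) ≤ gagSq u ^ 2 * (((v x * v x) * (v x * v x)) * primF f (v x))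
      have e5 : (u x * u x) * (u x * u x) = gagSq u ^ 2 * ((v x * v x) * (v x * v x)) := by
        rw [← hρ2, eu]; ring
      rw [e5, mul_assoc]
      have : 0 ≤ v x * v x * (v x * v x) := by positivity
      gcongr
    have b3 : a * ∫ x, u x ^ 2 ∂mu ≤ a / lam1' * gagSq u := by
      have : ∫ x, u x ^ 2 ∂mu ≤ gagSq u / lam1' := by rw [le_div_iff₀ hl]; linarith
      have := mul_le_mul_of_nonneg_left this h.a0
      refine this.trans (le_of_eq (by ring))
    have b4 : 1 / τ ^ 4 * (gagSq u ^ 2 * C) ≤ d / 2 * gagSq u := by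
      rw [le_div_iff₀ (by positivity)] at hg2
      rw [one_div, inv_mul_eq_div, div_le_iff₀ (by positivity)]
      nlinarith
    have b5 : 1 / τ ^ 4 * ∫ x, ((u x * u x) * (u x * u x)) * primF f (u x) ∂mu ≤ 1 / τ ^ 4 * (gagSq u ^ 2 * C) :=
      mul_le_mul_of_nonneg_left b2 (by positivity)
    have e6 : gagSq u / (4 * π) = d * gagSq u + a / lam1' * gagSq u := by rw [hd]; ring
    rw [JJ]
    linarith

lemma mu_univ : mu.real univ = 2 := by
  simp [mu, Measure.real, Real.volume_Ioo]; norm_num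

lemma exists_e (hl : 0 < lam1') : ∃ e, KK e ∧ 0 < ∫ x, e x ^ 3 ∂mu := by
  set h : ℝ → ℝ := indicator (Ioo (-1) 1) (fun _ => 1) with hh
  have hhL : MemLp h 2 volume := (memLp_indicator_iff_restrict measurableSet_Ioo).2
    (show MemLp (fun _ : ℝ => (1 : ℝ)) 2 mu from memLp_const 1)
  obtain ⟨e, he, heq⟩ := res_K one_pos hhL (fun x => indicator_nonneg (fun x _ => zero_le_one) x)
    (fun x y hxy => by
      by_cases hy : y ∈ Ioo (-1 : ℝ) 1
      · have hx : x ∈ Ioo (-1 : ℝ) 1 := abs_lt.1 (hxy.trans_lt (abs_lt.2 hy))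
        rw [hh, indicator_of_mem hy, indicator_of_mem hx]
      · rw [hh, indicator_of_notMem hy]
        exact indicator_nonneg (fun x _ => zero_le_one) x)
  have h30 : ∀ x, 0 ≤ e x ^ 3 := fun x => pow_nonneg (he.2.1 x) 3
  refine ⟨e, he, (integral_nonneg h30).lt_of_ne fun h0 => ?_⟩
  have hz := (integral_eq_zero_iff_of_nonneg h30 (he.iq (q := fun t => t ^ 3) (by fun_prop))).1 h0.symm
  have hz2 : e =ᵐ[volume] fun _ => 0 := by
    have h1 : ∀ᵐ x, x ∈ Ioo (-1 : ℝ) 1 → e x ^ 3 = 0 := (ae_restrict_iff' measurableSet_Ioo).1 hz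
    filter_upwards [h1, he.1.off] with x h2 h3
    by_cases hx : x ∈ Ioo (-1 : ℝ) 1
    · simpa using h2 hx
    · exact h3 hx
  obtain ⟨v, hv, hv1⟩ := exists_of_lam1 hl
  have hvX : memX' (fun x => |v x|) := hv.dom hv.meas.abs (fun x y => abs_abs_sub_abs_le _ _) (fun x => by simp)
  have e1 := heq _ hvX
  have e2 : innerX e (fun x => |v x|) = 0 := by
    rw [innerX_congr hz2 (ae_eq_refl _)]
    simp [innerX, innerKer]
  have e3 : ∫ x, e x * |v x| = 0 := by
    refine integral_eq_zero_of_ae ?_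
    filter_upwards [hz2] with x hx
    rw [hx]; simp
  rw [e2, e3, ← set_int_eq hvX.off] at e1
  have e4 : ∫ x in Ioo (-1 : ℝ) 1, |v x| = 0 := by
    have : ∫ x in Ioo (-1 : ℝ) 1, h x * |v x| = ∫ x in Ioo (-1 : ℝ) 1, |v x| :=
      setIntegral_congr_fun measurableSet_Ioo fun x hx => by simp only [hh, indicator_of_mem hx, one_mul]
    rw [← this, ← e1]; simp
  have i1 : Integrable v mu := hv.mLp.integrable (by norm_num)
  have e5 := (integral_eq_zero_iff_of_nonneg (μ := mu) (fun x => abs_nonneg (v x)) i1.abs).1 e4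
  have : ∫ x in Ioo (-1 : ℝ) 1, v x ^ 2 = 0 := by
    refine integral_eq_zero_of_ae ?_
    filter_upwards [e5] with x hx
    have : v x = 0 := by simpa using hx
    simp [this]
  linarith

lemma FF.approx {ω : ℝ} (hω : 0 < ω) (hTM : TMprop' ω) (h : FF f M R a τ) :
    ∃ r > 0, ∃ B, 0 ≤ B ∧ ∀ n : ℕ, ∃ u, KK u ∧ r ≤ gagSq u ∧ gagSq u ≤ B ∧
      ∀ v, memX' v → |innerX u v / (2 * π) - ∫ x, kreg f ((n : ℝ) + 1) (u x) * v x ∂mu|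
        ≤ 1 / ((n : ℝ) + 1) * (1 + gagSq v) := by
  have hπ := Real.pi_pos
  obtain ⟨r, hr, c, hc, hsb⟩ := h.small hω hTM
  obtain ⟨e, he, hE⟩ := exists_e h.lam
  obtain ⟨b, hb, hcube⟩ := h.k_cube
  set E := ∫ x, e x ^ 3 ∂mu with hEd
  set g := gagSq e / (4 * π) with hg
  have hR := h.Rp
  have hg0 : 0 ≤ g := by have := gagSq_nonneg e; positivity
  have hJT : ∀ L, 0 < L → ∀ T, 0 ≤ T → JJ (kreg f L) (fun x => T * e x) ≤ g * T ^ 2 - b * E * T ^ 3 + 2 * b * R ^ 3 := by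
    intro L hL T hT
    have hTe : KK (fun x => T * e x) := by
      have := he.comb he hT le_rfl
      simpa using this
    have h3 : Integrable (fun x => e x ^ 3) mu := he.iq (q := fun t => t ^ 3) (by fun_prop)
    have h1 : b * (T ^ 3 * E - R ^ 3 * 2) ≤ ∫ x, primF (kreg f L) (T * e x) ∂mu := by
      have : b * (T ^ 3 * E - R ^ 3 * 2) = ∫ x, b * (T ^ 3 * e x ^ 3 - R ^ 3) ∂mu := by
        rw [integral_const_mul, integral_sub (h3.const_mul _) (integrable_const _), integral_const_mul,
          integral_const, mu_univ, smul_eq_mul]; ring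
      rw [this]
      refine integral_mono (((h3.const_mul _).sub (integrable_const _)).const_mul _)
        (hTe.iq (primF_cont (h.k_cont hL))) fun x => ?_
      have := hcube L hL (T * e x) (hTe.2.1 x)
      rw [mul_pow] at this
      exact this
    rw [JJ, gagSq_smul]
    have : T ^ 2 * gagSq e / (4 * π) = g * T ^ 2 := by rw [hg]; ring
    rw [this]; linarith
  set T1 := g / (b * E) with hT1
  have hT10 : 0 ≤ T1 := by positivity
  have hT1e : g = b * E * T1 := by rw [hT1]; field_simp
  have hneg : ∀ L, 0 < L → ∃ T, 0 ≤ T ∧ JJ (kreg f L) (fun x => T * e x) < 0 := by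
    intro L hL
    set s := 1 + 2 * R ^ 3 / E with hs
    have hs1 : 1 ≤ s := by rw [hs]; have : 0 ≤ 2 * R ^ 3 / E := by positivity
                           linarith
    refine ⟨T1 + s, by positivity, (hJT L hL _ (by positivity)).trans_lt ?_⟩
    have hEs : E * s = E + 2 * R ^ 3 := by rw [hs]; field_simp
    have h1 : g * (T1 + s) ^ 2 - b * E * (T1 + s) ^ 3 + 2 * b * R ^ 3
        = - (b * (E * s)) * (T1 + s) ^ 2 + 2 * b * R ^ 3 := by rw [hT1e]; ring
    rw [h1, hEs]
    have h2 : 1 ≤ (T1 + s) ^ 2 := by nlinarith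
    have h3 : b * (E + 2 * R ^ 3) * 1 ≤ b * (E + 2 * R ^ 3) * (T1 + s) ^ 2 :=
      mul_le_mul_of_nonneg_left h2 (by positivity)
    have : 0 < b * E := by positivity
    linarith
  set C := g * T1 ^ 2 + 2 * b * R ^ 3 with hCd
  have hC0 : 0 ≤ C := by positivity
  have hCb : ∀ L, 0 < L → ∀ T, 0 ≤ T → JJ (kreg f L) (fun x => T * e x) ≤ C := by
    intro L hL T hT
    refine (hJT L hL T hT).trans ?_
    rw [hCd]
    rcases le_total T T1 with hc | hc
    · have h1 : g * T ^ 2 ≤ g * T1 ^ 2 := by gcongr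
      have : 0 ≤ b * E * T ^ 3 := by positivity
      linarith
    · have h1 : g * T ^ 2 ≤ b * E * T ^ 3 := by
        rw [hT1e]
        have : b * E * T1 * T ^ 2 ≤ b * E * T * T ^ 2 := by gcongr
        linarith
      have : 0 ≤ g * T1 ^ 2 := by positivity
      linarith
  have hFR := (h.two R hR).1
  refine ⟨min r (4 * π * (c * r)), by positivity, 24 * π * (C + 2 * primF f R + 1), by positivity, fun n => ?_⟩
  have hn : (0 : ℝ) < (n : ℝ) + 1 := by positivity
  set L := (n : ℝ) + 1 with hLd
  obtain ⟨u, hu, hor, hJ, hv⟩ := mount hω hTM h.lam (h.nl hn) hr hc (hsb L hn) he (hneg L hn) (hCb L hn)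
    (show 0 < 1 / (8 * π * L) by positivity)
  have hFn : 0 ≤ ∫ x, primF (kreg f L) (u x) ∂mu := integral_nonneg fun x => (h.nl hn).Fnn (hu.2.1 x)
  have hL1 : 1 ≤ L := by rw [hLd]; have : (0 : ℝ) ≤ n := by positivity
                         linarith
  have h8 : 1 ≤ 8 * π := by linarith [Real.pi_gt_three]
  refine ⟨u, hu, ?_, ?_, fun v hvX => (hv v hvX).trans ?_⟩
  · rcases hor with h1 | h1
    · exact (min_le_left _ _).trans h1
    · refine (min_le_right _ _).trans ?_
      rw [JJ] at h1
      have : c * r ≤ gagSq u / (4 * π) := by linarith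
      rw [le_div_iff₀ (by positivity)] at this
      linarith
  · have h1 := (abs_le.1 (hv u hu.1)).1
    have hδ : 1 / (8 * π * L) ≤ 1 / (8 * π) := one_div_le_one_div_of_le (by positivity) (by nlinarith)
    have hgu := gagSq_nonneg u
    have h2 : 1 / (8 * π * L) * (1 + gagSq u) ≤ 1 / (8 * π) * (1 + gagSq u) := by gcongr
    have h3 : ∫ x, primF (kreg f L) (u x) ∂mu ≤ (∫ x, kreg f L (u x) * u x ∂mu) / 3 + 2 * primF f R := by
      have i1 := hu.iqv (h.k_cont hn) hu.1
      have : (∫ x, kreg f L (u x) * u x ∂mu) / 3 + 2 * primF f R = ∫ x, (kreg f L (u x) * u x / 3 + primF f R) ∂mu := by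
        rw [integral_add (i1.div_const _) (integrable_const _), integral_div, integral_const, mu_univ, smul_eq_mul]
      rw [this]
      exact integral_mono (hu.iq (primF_cont (h.k_cont hn))) ((i1.div_const _).add (integrable_const _))
        fun x => h.k_ar hn (hu.2.1 x)
    rw [JJ] at hJ
    rw [← gagSq_eq] at h1
    set G := gagSq u
    have e1 : G / (4 * π) = 6 * (G / (24 * π)) := by field_simp; ring
    have e2 : G / (2 * π) = 12 * (G / (24 * π)) := by field_simp; ring
    have e3 : 1 / (8 * π) * (1 + G) = 1 / (8 * π) + 3 * (G / (24 * π)) := by field_simp; ring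
    have e4 : 1 / (8 * π) ≤ 1 := by rw [div_le_one (by positivity)]; exact h8
    have : G / (24 * π) ≤ C + 2 * primF f R + 1 := by linarith
    rw [div_le_iff₀ (by positivity)] at this
    linarith
  · have := gagSq_nonneg v
    have : 1 / (8 * π * L) ≤ 1 / L := by gcongr; nlinarith
    gcongr

end appr


lemma helly {g : ℕ → ℝ → ℝ} {b : ℝ → ℝ} (hg : ∀ n, Antitone (g n)) (h0 : ∀ n y, 0 ≤ g n y)
    (hb : ∀ n y, g n y ≤ b y) : ∃ φ : ℕ → ℕ, StrictMono φ ∧ ∃ G : ℝ → ℝ, Antitone G ∧ (∀ y, 0 ≤ G y) ∧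
      {y | ¬ Tendsto (fun n => g (φ n) y) atTop (𝓝 (G y))}.Countable := by
  have hc : IsCompact (Set.pi univ fun q : ℚ => Icc (0 : ℝ) (b q)) :=
    isCompact_univ_pi fun q => isCompact_Icc
  obtain ⟨a, ha, φ, hφ, hlim⟩ := hc.tendsto_subseq (x := fun n (q : ℚ) => g n q)
    (fun n q _ => ⟨h0 n q, hb n q⟩)
  rw [tendsto_pi_nhds] at hlim
  have ha0 : ∀ q, 0 ≤ a q := fun q => (ha q (mem_univ q)).1
  have hne : ∀ y : ℝ, Nonempty {q : ℚ // (q : ℝ) < y} := fun y => by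
    obtain ⟨q, hq⟩ := exists_rat_lt y
    exact ⟨q, hq⟩
  have hbd : ∀ y : ℝ, BddBelow (range fun q : {q : ℚ // (q : ℝ) < y} => a q) := fun y =>
    ⟨0, by rintro _ ⟨q, rfl⟩; exact ha0 q⟩
  set G : ℝ → ℝ := fun y => ⨅ q : {q : ℚ // (q : ℝ) < y}, a q with hG
  have hGa : Antitone G := fun x y hxy => by
    have := hne x
    exact le_ciInf fun q => ciInf_le (hbd y) ⟨q.1, q.2.trans_le hxy⟩
  refine ⟨φ, hφ, G, hGa, fun y => ?_, ?_⟩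
  · have := hne y
    exact le_ciInf fun q => ha0 q
  refine Set.Countable.mono ?_ hGa.countable_not_continuousAt
  intro y hy hcont
  apply hy
  refine tendsto_order.2 ⟨fun c hc => ?_, fun c hc => ?_⟩
  · have h1 : ∀ᶠ z in 𝓝 y, c < G z := hcont.eventually (lt_mem_nhds hc)
    have h2 : ∀ᶠ z in 𝓝[>] y, c < G z ∧ y < z :=
      (h1.filter_mono nhdsWithin_le_nhds).and self_mem_nhdsWithin
    obtain ⟨z, hz, hyz⟩ := h2.exists
    obtain ⟨q, hq1, hq2⟩ := exists_rat_btwn hyz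
    have h3 : c < a q := hz.trans_le (ciInf_le (hbd z) ⟨q, hq2⟩)
    filter_upwards [(hlim q).eventually (lt_mem_nhds h3)] with n hn
    exact lt_of_lt_of_le hn (hg _ hq1.le)
  · have := hne y
    obtain ⟨q, hq⟩ := exists_lt_of_ciInf_lt hc
    filter_upwards [(hlim q).eventually (gt_mem_nhds hq)] with n hn
    exact lt_of_le_of_lt (hg _ q.2.le) hn

lemma KK.ptw {u : ℝ → ℝ} (hu : KK u) (y : ℝ) : u (exp y) ^ 2 * exp y ≤ ∫ x, u x ^ 2 := by
  have h1 : ∫ x in Ioo 0 (exp y), u (exp y) ^ 2 ≤ ∫ x in Ioo 0 (exp y), u x ^ 2 := by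
    refine setIntegral_mono_on (by simp) hu.1.sqi.integrableOn measurableSet_Ioo fun x hx => ?_
    have := hu.2.2 x (exp y) (by rw [abs_of_pos hx.1, abs_of_pos (exp_pos y)]; exact hx.2.le)
    have := hu.2.1 (exp y)
    gcongr
  have h2 : ∫ x in Ioo 0 (exp y), u x ^ 2 ≤ ∫ x, u x ^ 2 :=
    setIntegral_le_integral hu.1.sqi (ae_of_all _ fun x => sq_nonneg _)
  refine le_trans (le_of_eq ?_) (h1.trans h2)
  simp [(exp_pos y).le, mul_comm]

lemma KK.seq {u : ℕ → ℝ → ℝ} (hu : ∀ n, KK (u n)) {B : ℝ} (hB : 0 ≤ B) (hl : 0 < lam1')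
    (hg : ∀ n, gagSq (u n) ≤ B) : ∃ φ : ℕ → ℕ, StrictMono φ ∧ ∃ w, KP w ∧
      ∀ᵐ x : ℝ, Tendsto (fun n => u (φ n) x) atTop (𝓝 (w x)) := by
  have hsq : ∀ n, ∫ x, u n x ^ 2 ≤ B / lam1' := fun n => by
    rw [le_div_iff₀ hl, ← set_int_sq (hu n).1, mul_comm]
    exact (mu_poinc (hu n).1).trans (hg n)
  obtain ⟨φ, hφ, G, hGa, hG0, hGc⟩ := helly (g := fun n y => u n (exp y))
    (b := fun y => 1 + B / lam1' / exp y)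
    (fun n y z hyz => (hu n).2.2 _ _ (by
      rw [abs_of_pos (exp_pos y), abs_of_pos (exp_pos z)]; exact exp_le_exp.2 hyz))
    (fun n y => (hu n).2.1 _) (fun n y => by
      have h1 := ((hu n).ptw y).trans (hsq n)
      rw [← le_div_iff₀ (exp_pos y)] at h1
      show u n (exp y) ≤ 1 + B / lam1' / exp y
      nlinarith [sq_nonneg (u n (exp y) - 1)])
  set w : ℝ → ℝ := fun x => G (log |x|) with hw
  have hlim : ∀ᵐ x : ℝ, Tendsto (fun n => u (φ n) x) atTop (𝓝 (w x)) := by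
    set S := {y | ¬ Tendsto (fun n => u (φ n) (exp y)) atTop (𝓝 (G y))}
    have hc : ({0} ∪ exp '' S ∪ (fun y => - exp y) '' S : Set ℝ).Countable :=
      ((countable_singleton 0).union (hGc.image _)).union (hGc.image _)
    filter_upwards [compl_mem_ae_iff.2 (hc.measure_zero volume)] with x hx
    by_contra hcon
    apply hx
    by_cases h0 : x = 0
    · left; left; exact h0
    have hmem : log |x| ∈ S := by
      intro ht
      apply hcon
      refine ht.congr fun n => ?_
      rw [exp_log (abs_pos.2 h0)]
      exact le_antisymm ((hu _).2.2 _ _ (by simp)) ((hu _).2.2 _ _ (by simp))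
    rcases lt_or_gt_of_ne h0 with h | h
    · right
      exact ⟨_, hmem, by show - exp (log |x|) = x; rw [exp_log (abs_pos.2 h0), abs_of_neg h, neg_neg]⟩
    · left; right
      exact ⟨_, hmem, by rw [exp_log (abs_pos.2 h0), abs_of_pos h]⟩
  have hrad : ∀ x y, x ≠ 0 → |x| ≤ |y| → w y ≤ w x := fun x y hx hxy =>
    hGa (log_le_log (abs_pos.2 hx) hxy)
  have hwm : Measurable w := rad_meas hrad
  refine ⟨φ, hφ, w, ⟨⟨⟨hwm, ?_, ?_⟩, ?_⟩, fun x => hG0 _, hrad⟩, hlim⟩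
  · refine (fatou_int (h := fun n x => u (φ n) x ^ 2) (C := B / lam1') (by positivity)
      (fun n => (hu _).1.meas.pow_const 2) (hwm.pow_const 2) (fun n x => sq_nonneg _)
      (fun n => (hu _).1.sqi) (fun n => hsq _) ?_).1
    filter_upwards [hlim] with x hx using hx.pow 2
  · refine (fatou_int (h := fun n => gagKer (u (φ n))) (C := B) hB
      (fun n => measurable_gagKer (hu _).1.meas) (measurable_gagKer hwm) (fun n x => gagKer_nonneg _ _)
      (fun n => (hu _).1.gi) (fun n => hg _) ?_).1
    filter_upwards [(ae_prod_of_ae hlim)] with p hp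
    exact ((hp.1.sub hp.2).pow 2).div_const _
  · have hne : ∀ᵐ x : ℝ, x ≠ 1 ∧ x ≠ -1 := by
      filter_upwards [compl_mem_ae_iff.2 ((countable_singleton (1:ℝ)).measure_zero volume),
        compl_mem_ae_iff.2 ((countable_singleton (-1:ℝ)).measure_zero volume)] with x h1 h2
      exact ⟨h1, h2⟩
    filter_upwards [hlim, hne] with x hx hn hxo
    have h1 : 1 < |x| := by
      by_contra hcon
      rw [not_lt, abs_le] at hcon
      exact hxo ⟨lt_of_le_of_ne hcon.1 (Ne.symm hn.2), lt_of_le_of_ne hcon.2 hn.1⟩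
    refine tendsto_nhds_unique hx ?_
    simp only [(hu _).zero_off x h1]
    exact tendsto_const_nhds


theorem FF.main {f : ℝ → ℝ} {M R a τ ω : ℝ} (hω : 0 < ω) (hTM : TMprop' ω) (h : FF f M R a τ) :
    ∃ w, KP w ∧ ¬ (w =ᵐ[volume] fun _ => (0 : ℝ)) ∧ MemLp (fun x => f (w x)) 2 mu ∧
      ∀ v, memX' v → innerX w v / (2 * π) = ∫ x, f (w x) * v x ∂mu := by
  have hπ := Real.pi_pos
  obtain ⟨r, hr, B, hB, hap⟩ := h.approx hω hTM
  choose U hU hUr hUB hUe using hap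
  obtain ⟨φ, hφ, w, hw, hlim⟩ := KK.seq hU hB h.lam hUB
  set u : ℕ → ℝ → ℝ := fun n => U (φ n) with hu
  set L : ℕ → ℝ := fun n => (φ n : ℝ) + 1 with hL
  have hL0 : ∀ n, 0 < L n := fun n => by positivity
  have hLt : Tendsto L atTop atTop :=
    tendsto_atTop_add_const_right _ _ (tendsto_natCast_atTop_atTop.comp hφ.tendsto_atTop)
  have hLi : Tendsto (fun n => 1 / L n) atTop (𝓝 0) := by
    simp only [one_div]; exact tendsto_inv_atTop_zero.comp hLt
  have huK : ∀ n, KK (u n) := fun n => hU _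
  have hu0 : ∀ n x, 0 ≤ u n x := fun n x => (huK n).2.1 x
  have hkm : ∀ n, Measurable (fun x => kreg f (L n) (u n x)) := fun n =>
    (h.k_cont (hL0 n)).measurable.comp (huK n).1.meas
  have hk0 : ∀ n x, 0 ≤ kreg f (L n) (u n x) := fun n x => h.k_nn (hL0 n) (hu0 n x)
  have hkf : ∀ n x, kreg f (L n) (u n x) ≤ f (u n x) := fun n x => h.k_lef (hL0 n) (hu0 n x)
  have hfw : Measurable (fun x => f (w x)) := h.cont.measurable.comp hw.1.meas
  have hklim : ∀ᵐ x : ℝ, Tendsto (fun n => kreg f (L n) (u n x)) atTop (𝓝 (f (w x))) := by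
    filter_upwards [hlim] with x hx
    exact h.k_lim (fun n => hu0 n x) hL0 hx hLt
  refine ⟨w, hw, ?_, ?_, ?_⟩
  · intro hz
    have h1 := LIM (φ := fun _ => (1 : ℝ)) hω hTM (h.sub.mul SubC_id) B hB (fun n => (huK n).1) hu0 (fun n => hUB _)
      (h := fun n x => kreg f (L n) (u n x) * u n x) (g := fun _ => 0)
      (fun n => (hkm n).mul (huK n).1.meas) (fun n x => by
        rw [abs_of_nonneg (mul_nonneg (hk0 n x) (hu0 n x))]
        exact mul_le_mul_of_nonneg_right (hkf n x) (hu0 n x)) measurable_const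
      (ae_mu (by
        filter_upwards [hklim, hlim, hz] with x h1 h2 h3
        have := h1.mul h2
        simpa [h3] using this)) measurable_const (by simp)
    simp only [mul_one, integral_zero] at h1
    have h2 : ∀ n, r / (2 * π) ≤ (∫ x, kreg f (L n) (u n x) * u n x ∂mu) + 1 / L n * (1 + B) := fun n => by
      have h3 := (abs_le.1 (hUe (φ n) (u n) (huK n).1)).2
      rw [show innerX (U (φ n)) (u n) = gagSq (u n) from (gagSq_eq _).symm] at h3
      have h4 : 1 / L n * (1 + gagSq (u n)) ≤ 1 / L n * (1 + B) :=
        mul_le_mul_of_nonneg_left (by linarith [hUB (φ n)]) (one_div_pos.2 (hL0 n)).le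
      have h5 : r / (2 * π) ≤ gagSq (u n) / (2 * π) := div_le_div_of_nonneg_right (hUr _) (by positivity)
      linarith
    have h6 := h1.add (hLi.mul_const (1 + B))
    have h7 := ge_of_tendsto' h6 h2
    have : 0 < r / (2 * π) := by positivity
    linarith
  · obtain ⟨C, hC, hb⟩ := TMb hω hTM (h.sub.mul h.sub) B hB
    have hkb : ∀ n, Integrable (fun x => kreg f (L n) (u n x) ^ 2) mu ∧
        ∫ x, |kreg f (L n) (u n x) ^ 2| ∂mu ≤ C := fun n =>
      hb (u n) (huK n).1 (hu0 n) (hUB _) _ ((hkm n).pow_const 2) (fun x => by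
        rw [abs_of_nonneg (sq_nonneg _), sq]
        exact mul_le_mul (hkf n x) (hkf n x) (hk0 n x) ((hk0 n x).trans (hkf n x)))
    rw [memLp_two_iff_integrable_sq hfw.aestronglyMeasurable]
    refine (fatou_int hC (fun n => (hkm n).pow_const 2) (hfw.pow_const 2) (fun n x => sq_nonneg _)
      (fun n => (hkb n).1) (fun n => ?_) (ae_mu (by filter_upwards [hklim] with x hx using hx.pow 2))).1
    have := (hkb n).2
    simpa only [abs_of_nonneg (sq_nonneg (kreg f (L n) (u n _)))] using this
  · intro v hv
    have h1 : Tendsto (fun n => innerX (u n) v) atTop (𝓝 (innerX w v)) := by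
      have := weak_lim (μ := (volume : Measure (ℝ × ℝ))) (h := fun n => dK (u n)) (g := dK w) (φ := dK v) hB
        (fun n => measurable_dK (huK n).1.meas) (measurable_dK hw.1.meas) (measurable_dK hv.meas)
        (fun n => (huK n).1.dLp.integrable_sq) (fun n => by
          have := hUB (φ n)
          rw [gagSq, gagKer_eq] at this; exact this)
        (by
          filter_upwards [ae_prod_of_ae hlim] with p hp
          exact (hp.1.sub hp.2).div_const _) hv.dLp.integrable_sq
      simpa only [innerX, innerKer_eq] using this
    have h2 := LIM (φ := v) hω hTM h.sub B hB (fun n => (huK n).1) hu0 (fun n => hUB _)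
      hkm (fun n x => by rw [abs_of_nonneg (hk0 n x)]; exact hkf n x) hfw (ae_mu hklim) hv.meas hv.msq
    have h3 := ((h1.div_const (2 * π)).sub h2).abs
    have h4 := ge_of_tendsto' ((hLi.mul_const (1 + gagSq v)).sub h3) (b := 0)
      (fun n => by have := hUe (φ n) v hv; exact sub_nonneg.2 this)
    rw [zero_mul, zero_sub] at h4
    have h5 := abs_nonneg (innerX w v / (2 * π) - ∫ x, f (w x) * v x ∂mu)
    have h6 : |innerX w v / (2 * π) - ∫ x, f (w x) * v x ∂mu| = 0 := by linarith
    linarith [abs_eq_zero.1 h6]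

/-- existence of an even solution, nonincreasing on `[0,∞)`,
on the symmetric domain `(-1,1)` (Theorem 2). -/
theorem statement2 (ω : ℝ) (hω0 : 0 < ω) (hωπ : ω ≤ π) (hTM : TMprop' ω)
    (f : ℝ → ℝ) (hf : HypH f) :
    ∃ u : ℝ → ℝ, IsWeakSolution' f u ∧ ¬ (u =ᵐ[volume] (fun _ => (0 : ℝ))) ∧
      (∀ᵐ x : ℝ, u (-x) = u x) ∧ AntitoneOn u (Ici (0 : ℝ)) := by
  obtain ⟨M, R, a, τ, h⟩ := FF_of_HypH hf
  obtain ⟨w, hw, hnz, hfL, heq⟩ := h.main hω0 hTM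
  have hh : MemLp ((Ioo (-1 : ℝ) 1).indicator fun x => f (w x)) 2 volume :=
    (memLp_indicator_iff_restrict measurableSet_Ioo).2 hfL
  obtain ⟨u, hu, hwu⟩ := KP_to_KK hw hh (fun v hv _ => by
    rw [heq v hv, ← set_int_eq hv.off]
    refine le_of_eq (setIntegral_congr_fun measurableSet_Ioo fun x hx => ?_)
    simp only [indicator_of_mem hx])
  refine ⟨u, ⟨hu.1, fun v hv => ⟨hu.iqv h.cont hv, ?_⟩⟩, fun hz => hnz (hwu.trans hz), ?_, ?_⟩
  · rw [← innerX_congr hwu (EventuallyEq.refl _ v), heq v hv]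
    refine integral_congr_ae (ae_mu ?_)
    filter_upwards [hwu] with x hx
    rw [hx]
  · exact ae_of_all _ fun x => le_antisymm (hu.2.2 _ _ (by simp)) (hu.2.2 _ _ (by simp))
  · intro x hx y hy hxy
    exact hu.2.2 x y (by rw [abs_of_nonneg hx, abs_of_nonneg hy]; exact hxy)
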